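/- arXiv:1702.07703 — 2 statements merged into one kernel-verified Lean document; each statement's English description precedes it below -/
import Mathlib

section
/- Let q ≥ 5 be odd and ε = 1/2. Let θ_q = q cos(π/q)/(1 + cos(π/q)), q′ = 1 + 1/cos(π/q), and for δ ∈ (0, (q′−1)/q′] let R_LP1(q′, δ) = h_{q′}( ((q′−1) − (q′−2)δ − 2√((q′−1)δ(1−δ)))/q′ ), where h_{q′}(x) = x log₂(q′−1) − x log₂ x − (1−x) log₂(1−x). Let h₃(x) = x log₂ 2 − x log₂ x − (1−x) log₂(1−x), which is strictly increasing on [0, 2/3]. Suppose the rate R satisfies log₂ θ_q < R < log₂ q and R ≥ log₂(q/3); let δ₀ ∈ [0, 2/3] be the unique solution of h₃(δ₀) = log₂ q − R, let s ∈ (0, (q′−1)/q′) satisfy R = log₂ θ_q + R_LP1(q′, s), and assume δ₀ ≤ s. Then the reliability function satisfies E(R) ≤ max over δ ∈ [δ₀, s] and τ ∈ [δ, s] of min( δ, τ − min( R − (log₂ q − h₃(τ)), δ/2 ) ). -/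
/-- The typewriter channel transition probabilities on `ZMod q`. -/
noncomputable def W (q : ℕ) (ε : ℝ) (y x : ZMod q) : ℝ :=
  if y = x then 1 - ε else if y = x + 1 then ε else 0

/-- `α_ε = √(ε(1-ε))`. -/
noncomputable def alphaE (ε : ℝ) : ℝ := Real.sqrt (ε * (1 - ε))

/-- The `n`-fold memoryless extension `Wⁿ(y|x) = ∏ₖ W(yₖ|xₖ)`. -/
noncomputable def Wn (q : ℕ) [NeZero q] (n : ℕ) (ε : ℝ) (y x : Fin n → ZMod q) : ℝ :=
  ∏ k, W q ε (y k) (x k)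

/-- `Pe(M,n)`: the smallest average error probability over all encoders
`f : Fin M → (ZMod q)ⁿ` and decoders `φ : (ZMod q)ⁿ → Fin M`. -/
noncomputable def Pe (q : ℕ) [NeZero q] (ε : ℝ) (M n : ℕ) : ℝ :=
  sInf {p : ℝ | ∃ f : Fin M → (Fin n → ZMod q), ∃ φ : (Fin n → ZMod q) → Fin M,
    p = (1 / M) * ∑ m : Fin M, ∑ y : Fin n → ZMod q,
      if φ y = m then 0 else Wn q n ε y (f m)}

/-- The reliability function
`E(R) = limsup_{n→∞} (1/n) log₂ (1 / Pe(⌈2^{nR}⌉, n))`. -/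
noncomputable def EReliability (q : ℕ) [NeZero q] (ε : ℝ) (R : ℝ) : ℝ :=
  Filter.limsup (fun n : ℕ =>
    (1 / (n : ℝ)) * Real.logb 2 (1 / Pe q ε (⌈(2 : ℝ) ^ ((n : ℝ) * R)⌉₊) n))
    Filter.atTop

/-- Binary entropy function (base 2), extended by `log 0 = 0`. -/
noncomputable def h2 (x : ℝ) : ℝ := -(x * Real.logb 2 x) - (1 - x) * Real.logb 2 (1 - x)

/-- The `q'`-ary entropy function `h_{q'}(x) = x log₂(q'-1) - x log₂ x - (1-x) log₂(1-x)`
(with a not-necessarily-integral parameter `q'`). -/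
noncomputable def hqary (q' x : ℝ) : ℝ :=
  x * Real.logb 2 (q' - 1) - x * Real.logb 2 x - (1 - x) * Real.logb 2 (1 - x)

/-- The first linear-programming (MRRW) bound for a (possibly non-integral) `q'`-ary
Hamming space: `R_LP1(q', δ) = h_{q'}( ((q'-1) - (q'-2)δ - 2√((q'-1)δ(1-δ)))/q' )`. -/
noncomputable def RLP1 (q' δ : ℝ) : ℝ :=
  hqary q' (((q' - 1) - (q' - 2) * δ - 2 * Real.sqrt ((q' - 1) * δ * (1 - δ))) / q')

/-- Ternary-type entropy `h₃(x) = x log₂ 2 - x log₂ x - (1-x) log₂(1-x)`. -/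
noncomputable def h3 (x : ℝ) : ℝ :=
  x * Real.logb 2 2 - x * Real.logb 2 x - (1 - x) * Real.logb 2 (1 - x)

namespace Typewriter

open Finset

/-! ### Positive definiteness on `(ZMod q)ⁿ` -/

/-- If every `w i` has a nonnegative Fourier transform `v i`, the pair sum of `∏ i, w i` over a
family of words dominates the contribution of the trivial character. -/
theorem card_sq_mul_prod_le_sum_sum {q n : ℕ} [NeZero q] {ι : Type*} (I : Finset ι)
    (f : ι → Fin n → ZMod q) (w v : Fin n → ZMod q → ℝ) (hv : ∀ i k, 0 ≤ v i k)
    (hw : ∀ i z, (q : ℂ) * (w i z : ℂ) = ∑ k, (v i k : ℂ) * ZMod.stdAddChar (k * z)) :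
    (∏ i, v i 0) * (#I : ℝ) ^ 2 ≤
      (q : ℝ) ^ n * ∑ a ∈ I, ∑ b ∈ I, ∏ i, w i (f b i - f a i) := by
  have key : (((q : ℝ) ^ n * ∑ a ∈ I, ∑ b ∈ I, ∏ i, w i (f b i - f a i) : ℝ) : ℂ) =
      ((∑ k : Fin n → ZMod q, (∏ i, v i (k i)) *
        Complex.normSq (∑ a ∈ I, ∏ i, (ZMod.stdAddChar (k i * f a i) : ℂ)) : ℝ) : ℂ) := by
    push_cast
    have h1 : ∀ a b, (q : ℂ) ^ n * ∏ i, (w i (f b i - f a i) : ℂ) =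
        ∑ k : Fin n → ZMod q, (∏ i, (v i (k i) : ℂ)) *
          ((∏ i, (ZMod.stdAddChar (k i * f b i) : ℂ)) *
            (starRingEnd ℂ) (∏ i, (ZMod.stdAddChar (k i * f a i) : ℂ))) := by
      intro a b
      have : (q : ℂ) ^ n = ∏ _i : Fin n, (q : ℂ) := by simp
      rw [this, ← Finset.prod_mul_distrib]
      simp_rw [hw]
      rw [Fintype.prod_sum]
      refine Finset.sum_congr rfl fun k _ => ?_
      rw [map_prod, ← Finset.prod_mul_distrib, ← Finset.prod_mul_distrib]
      refine Finset.prod_congr rfl fun i _ => ?_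
      rw [← AddChar.map_neg_eq_conj, ← AddChar.map_add_eq_mul]
      congr 2
      ring
    simp_rw [Finset.mul_sum, h1]
    have h2 : ∀ k : Fin n → ZMod q,
        ((Complex.normSq (∑ a ∈ I, ∏ i, (ZMod.stdAddChar (k i * f a i) : ℂ)) : ℝ) : ℂ) =
        ∑ a ∈ I, ∑ b ∈ I, (∏ i, (ZMod.stdAddChar (k i * f b i) : ℂ)) *
            (starRingEnd ℂ) (∏ i, (ZMod.stdAddChar (k i * f a i) : ℂ)) := by
      intro k
      rw [← Complex.mul_conj, map_sum, Finset.sum_mul_sum, Finset.sum_comm]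
    simp_rw [h2, Finset.mul_sum]
    rw [Finset.sum_congr rfl (fun a _ => Finset.sum_comm), Finset.sum_comm]
  have key' := Complex.ofReal_injective key
  rw [key']
  refine le_trans (le_of_eq ?_) (Finset.single_le_sum (f := fun k : Fin n → ZMod q =>
    (∏ i, v i (k i)) * Complex.normSq (∑ a ∈ I, ∏ i, (ZMod.stdAddChar (k i * f a i) : ℂ)))
    (fun k _ => mul_nonneg (Finset.prod_nonneg fun i _ => hv i _) (Complex.normSq_nonneg _))
    (Finset.mem_univ 0))
  simp [Complex.normSq_apply, sq]

/-- The function on `ZMod q` with value `a` at `0` and `b * β / 2` at `±1`. -/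
noncomputable def letter (q : ℕ) (β a b : ℝ) (z : ZMod q) : ℝ :=
  if z = 0 then a else if z = 1 ∨ z = -1 then b * (β / 2) else 0

/-- The Fourier transform of `letter q β a b`. -/
noncomputable def letterHat (q : ℕ) [NeZero q] (β a b : ℝ) (k : ZMod q) : ℝ :=
  a + b * (β * (ZMod.stdAddChar k : ℂ).re)

theorem letter_fourier {q : ℕ} [NeZero q] (hq : 3 ≤ q) (β a b : ℝ) (z : ZMod q) :
    (q : ℂ) * (letter q β a b z : ℂ) =
      ∑ k, (letterHat q β a b k : ℂ) * ZMod.stdAddChar (k * z) := by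
  have hre : ∀ k : ZMod q, (((ZMod.stdAddChar k : ℂ).re : ℝ) : ℂ) =
      (ZMod.stdAddChar k + ZMod.stdAddChar (-k)) / 2 := by
    intro k
    rw [AddChar.map_neg_eq_conj, Complex.add_conj]
    push_cast
    ring
  have hsum : ∀ c : ZMod q, ∑ k : ZMod q, (ZMod.stdAddChar (k * c) : ℂ) =
      if c = 0 then (q : ℂ) else 0 := by
    intro c
    rw [AddChar.sum_mulShift c (ZMod.isPrimitive_stdAddChar q), ZMod.card]
    split_ifs <;> simp
  have hterm : ∀ k : ZMod q, (letterHat q β a b k : ℂ) * ZMod.stdAddChar (k * z) =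
      a * ZMod.stdAddChar (k * z) + (b * (β / 2)) * ZMod.stdAddChar (k * (z + 1)) +
        (b * (β / 2)) * ZMod.stdAddChar (k * (z - 1)) := by
    intro k
    have e1 : k * (z + 1) = k + k * z := by ring
    have e2 : k * (z - 1) = -k + k * z := by ring
    rw [e1, e2, AddChar.map_add_eq_mul, AddChar.map_add_eq_mul]
    unfold letterHat
    push_cast
    rw [hre]
    ring
  simp_rw [hterm, Finset.sum_add_distrib, ← Finset.mul_sum, hsum]
  have : Fact (2 < q) := ⟨by omega⟩
  have h11 : (-1 : ZMod q) ≠ 1 := ZMod.neg_one_ne_one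
  have : Fact (1 < q) := ⟨by omega⟩
  have h10 : (1 : ZMod q) ≠ 0 := one_ne_zero
  unfold letter
  by_cases h0 : z = 0
  · subst h0
    simp [mul_comm]
  · by_cases h1 : z = 1
    · subst h1
      have : (1 + 1 : ZMod q) ≠ 0 := by
        intro h
        exact h11 (by rw [neg_eq_iff_add_eq_zero]; exact h)
      simp [this, mul_comm]
    · by_cases h2 : z = -1
      · subst h2
        have : (-1 - 1 : ZMod q) ≠ 0 := by
          intro h
          exact h11 (sub_eq_zero.1 h)
        simp [this, mul_comm]
      · have e1 : z + 1 ≠ 0 := fun h => h2 (eq_neg_of_add_eq_zero_left h)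
        have e2 : z - 1 ≠ 0 := fun h => h1 (sub_eq_zero.1 h)
        simp [h0, h1, h2, e1, e2]

theorem stdAddChar_re {q : ℕ} [NeZero q] (k : ZMod q) :
    (ZMod.stdAddChar k : ℂ).re = Real.cos (2 * Real.pi * k.val / q) := by
  rw [ZMod.stdAddChar_apply, ZMod.toCircle_apply]
  have : 2 * (Real.pi : ℂ) * Complex.I * (k.val : ℂ) / (q : ℂ) =
      ((2 * Real.pi * k.val / q : ℝ) : ℂ) * Complex.I := by
    push_cast; ring
  rw [this, Complex.exp_ofReal_mul_I_re]

theorem stdAddChar_re_le_one {q : ℕ} [NeZero q] (k : ZMod q) :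
    (ZMod.stdAddChar k : ℂ).re ≤ 1 := by
  rw [stdAddChar_re]
  exact Real.cos_le_one _

theorem neg_cos_le_stdAddChar_re {q : ℕ} [NeZero q] (hqo : Odd q) (k : ZMod q) :
    -Real.cos (Real.pi / q) ≤ (ZMod.stdAddChar k : ℂ).re := by
  rw [stdAddChar_re]
  have hq0 : (0 : ℝ) < q := by exact_mod_cast Nat.pos_of_ne_zero (NeZero.ne q)
  have hk : k.val < q := ZMod.val_lt k
  have hne : (2 * (k.val : ℤ) - q) ≠ 0 := by
    obtain ⟨r, hr⟩ := hqo
    omega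
  have habs : (1 : ℝ) ≤ |2 * (k.val : ℝ) - q| := by
    exact_mod_cast Int.one_le_abs hne
  have habs2 : |2 * (k.val : ℝ) - q| ≤ q := by
    have hk' : (k.val : ℝ) < q := by exact_mod_cast hk
    have h0 : (0 : ℝ) ≤ k.val := by positivity
    rw [abs_le]; constructor <;> linarith
  have hpi := Real.pi_pos
  have e : 2 * Real.pi * k.val / q = Real.pi / q * (2 * (k.val : ℝ) - q) + Real.pi := by
    field_simp; ring
  rw [e, Real.cos_add_pi, neg_le_neg_iff, ← Real.cos_abs, abs_mul, abs_of_pos (by positivity)]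
  apply Real.cos_le_cos_of_nonneg_of_le_pi (by positivity)
  · calc Real.pi / q * |2 * (k.val : ℝ) - q| ≤ Real.pi / q * q := by gcongr
      _ = Real.pi := by field_simp
  · exact le_mul_of_one_le_right (by positivity) habs

/-! ### Characters of the weighted cube -/

/-- The character indexed by `T` of the weighted cube (subsets `S`, weight `β ^ #S`). -/
noncomputable def chi {n : ℕ} (β : ℝ) (T S : Finset (Fin n)) : ℝ :=
  ∏ i ∈ T, if i ∈ S then -1 else β

theorem chi_eq_prod_univ {n : ℕ} (β : ℝ) (T S : Finset (Fin n)) :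
    chi β T S = ∏ i, if i ∈ T then (if i ∈ S then -1 else β) else 1 := by
  unfold chi
  rw [Finset.prod_ite_mem, Finset.univ_inter]

theorem sum_prod_ite_mem {n : ℕ} (a b : Fin n → ℝ) :
    ∑ S : Finset (Fin n), ∏ i, (if i ∈ S then a i else b i) = ∏ i, (a i + b i) := by
  rw [Finset.prod_add, Finset.powerset_univ]
  refine Finset.sum_congr rfl fun S _ => ?_
  rw [Finset.prod_ite]
  congr 1
  · congr 1; ext; simp
  · congr 1; ext; simp

theorem prod_ite_eq_finset {n : ℕ} (a b : ℝ) (T U : Finset (Fin n)) :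
    ∏ i, (if i ∈ T then (if i ∈ U then a * b else 0) else (if i ∈ U then 0 else b)) =
      if T = U then a ^ #T * b ^ n else 0 := by
  split_ifs with h
  · subst h
    have : ∀ i : Fin n, (if i ∈ T then (if i ∈ T then a * b else 0) else
        (if i ∈ T then 0 else b)) = (if i ∈ T then a else 1) * b := by
      intro i; split_ifs <;> simp
    simp_rw [this, Finset.prod_mul_distrib]
    simp
  · have : ∃ i, ¬ (i ∈ T ↔ i ∈ U) := by
      by_contra! hc
      exact h (Finset.ext hc)
    obtain ⟨i, hi⟩ := this
    apply Finset.prod_eq_zero (Finset.mem_univ i)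
    by_cases h1 : i ∈ T <;> by_cases h2 : i ∈ U <;> simp_all

theorem sum_chi_mul_chi {n : ℕ} (β : ℝ) (T U : Finset (Fin n)) :
    ∑ S : Finset (Fin n), β ^ #S * (chi β T S * chi β U S) =
      if T = U then β ^ #T * (1 + β) ^ n else 0 := by
  rw [← prod_ite_eq_finset]
  have : ∀ S : Finset (Fin n), β ^ #S * (chi β T S * chi β U S) =
      ∏ i, if i ∈ S then
          β * ((if i ∈ T then -1 else 1) * (if i ∈ U then -1 else 1))
        else ((if i ∈ T then β else 1) * (if i ∈ U then β else 1)) := by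
    intro S
    have hS : β ^ #S = ∏ i, if i ∈ S then β else 1 := by
      simp
    rw [hS, chi_eq_prod_univ, chi_eq_prod_univ, ← Finset.prod_mul_distrib,
      ← Finset.prod_mul_distrib]
    refine Finset.prod_congr rfl fun i _ => ?_
    split_ifs <;> ring
  simp_rw [this]
  rw [sum_prod_ite_mem]
  refine Finset.prod_congr rfl fun i _ => ?_
  split_ifs <;> ring

theorem sum_mul_expansion_mul_expansion {n : ℕ} (β : ℝ) (g r : Finset (Fin n) → ℝ) :
    ∑ S : Finset (Fin n), β ^ #S * ((∑ T, g T * chi β T S) * (∑ U, r U * chi β U S)) =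
      (1 + β) ^ n * ∑ T, g T * r T * β ^ #T := by
  have : ∀ S : Finset (Fin n),
      β ^ #S * ((∑ T, g T * chi β T S) * (∑ U, r U * chi β U S)) =
      ∑ T, ∑ U, g T * r U * (β ^ #S * (chi β T S * chi β U S)) := by
    intro S
    rw [Finset.sum_mul_sum, Finset.mul_sum]
    refine Finset.sum_congr rfl fun T _ => ?_
    rw [Finset.mul_sum]
    refine Finset.sum_congr rfl fun U _ => ?_
    ring
  simp_rw [this]
  rw [Finset.sum_comm, Finset.mul_sum]
  refine Finset.sum_congr rfl fun T _ => ?_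
  rw [Finset.sum_comm]
  simp_rw [← Finset.mul_sum, sum_chi_mul_chi]
  simp
  ring

theorem ite_mul_chi {n : ℕ} (β : ℝ) (T S : Finset (Fin n)) (i : Fin n) :
    (if i ∈ S then -1 else β) * chi β T S =
      if i ∈ T then β * chi β (T.erase i) S + (β - 1) * chi β T S else chi β (insert i T) S := by
  split_ifs with hS hT hT
  · have : chi β T S = -1 * chi β (T.erase i) S := by
      unfold chi
      rw [← Finset.mul_prod_erase T _ hT, if_pos hS]
    rw [this]; ring
  · unfold chi
    rw [Finset.prod_insert hT, if_pos hS]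
  · have : chi β T S = β * chi β (T.erase i) S := by
      unfold chi
      rw [← Finset.mul_prod_erase T _ hT, if_neg hS]
    rw [this]; ring
  · unfold chi
    rw [Finset.prod_insert hT, if_neg hS]

theorem sum_mem_eq_sum_notMem {n : ℕ} (i : Fin n) (F : Finset (Fin n) → Finset (Fin n) → ℝ) :
    ∑ T with i ∈ T, F (T.erase i) T = ∑ U with i ∉ U, F U (insert i U) := by
  refine Finset.sum_bij' (fun T _ => T.erase i) (fun U _ => insert i U) ?_ ?_ ?_ ?_ ?_
  · intro T hT; simp
  · intro T hT; simp
  · intro T hT; exact Finset.insert_erase (by simpa using hT)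
  · intro U hU; exact Finset.erase_insert (by simpa using hU)
  · intro T hT
    rw [Finset.insert_erase (by simpa using hT)]

theorem ite_mul_expansion {n : ℕ} (β : ℝ) (g : Finset (Fin n) → ℝ) (S : Finset (Fin n))
    (i : Fin n) :
    (if i ∈ S then -1 else β) * ∑ T, g T * chi β T S =
      ∑ U, (if i ∈ U then g (U.erase i) + (β - 1) * g U else β * g (insert i U)) * chi β U S := by
  have h1 : (if i ∈ S then -1 else β) * ∑ T, g T * chi β T S =
      ∑ T, (if i ∈ T then g T * (β * chi β (T.erase i) S + (β - 1) * chi β T S)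
        else g T * chi β (insert i T) S) := by
    rw [Finset.mul_sum]
    refine Finset.sum_congr rfl fun T _ => ?_
    rw [mul_left_comm, ite_mul_chi, mul_ite]
  rw [h1, Finset.sum_ite]
  simp_rw [ite_mul]
  rw [Finset.sum_ite]
  have e1 := sum_mem_eq_sum_notMem i (fun A B => g B * (β * chi β A S))
  have e2 := sum_mem_eq_sum_notMem i (fun A B => g A * chi β B S)
  have e3 : ∑ T with i ∈ T, g T * (β * chi β (T.erase i) S + (β - 1) * chi β T S) =
      ∑ T with i ∈ T, g T * (β * chi β (T.erase i) S) +
        ∑ T with i ∈ T, (β - 1) * g T * chi β T S := by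
    rw [← Finset.sum_add_distrib]
    refine Finset.sum_congr rfl fun T _ => ?_
    ring
  have e4 : ∑ T with i ∈ T, (g (T.erase i) + (β - 1) * g T) * chi β T S =
      ∑ T with i ∈ T, g (T.erase i) * chi β T S +
        ∑ T with i ∈ T, (β - 1) * g T * chi β T S := by
    rw [← Finset.sum_add_distrib]
    refine Finset.sum_congr rfl fun T _ => ?_
    ring
  rw [e3, e4, e1, e2]
  have e5 : ∀ T : Finset (Fin n), β * g (insert i T) * chi β T S =
    g (insert i T) * (β * chi β T S) := fun T => by ring
  simp_rw [e5]
  ring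

theorem sum_ite_mem_eq {n : ℕ} (a b : ℝ) (S : Finset (Fin n)) :
    ∑ i, (if i ∈ S then a else b) = #S * a + (n - #S) * b := by
  have : ∀ i : Fin n, (if i ∈ S then a else b) = b + if i ∈ S then a - b else 0 := by
    intro i; split_ifs <;> ring
  simp_rw [this, Finset.sum_add_distrib, Finset.sum_ite_mem]
  simp
  ring

/-- Multiplication by the first Krawtchouk function acts on radial expansions as a
tridiagonal operator. -/
theorem linear_mul_radial_expansion {n : ℕ} (β : ℝ) (γ : ℕ → ℝ) (S : Finset (Fin n)) :
    (β * n - (1 + β) * #S) * ∑ T, γ #T * chi β T S =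
      ∑ U : Finset (Fin n), (#U * γ (#U - 1) + (β - 1) * #U * γ #U + β * (n - #U) * γ (#U + 1)) *
        chi β U S := by
  have h : (β * n - (1 + β) * #S) = ∑ i : Fin n, (if i ∈ S then -1 else β) := by
    rw [sum_ite_mem_eq]; ring
  rw [h, Finset.sum_mul]
  simp_rw [ite_mul_expansion β (fun T => γ #T)]
  rw [Finset.sum_comm]
  refine Finset.sum_congr rfl fun U _ => ?_
  rw [← Finset.sum_mul]
  congr 1
  have : ∀ i : Fin n, (if i ∈ U then γ #(U.erase i) + (β - 1) * γ #U else β * γ #(insert i U)) =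
      if i ∈ U then γ (#U - 1) + (β - 1) * γ #U else β * γ (#U + 1) := by
    intro i
    split_ifs with hi
    · rw [Finset.card_erase_of_mem hi]
    · rw [Finset.card_insert_of_notMem hi]
  simp_rw [this, sum_ite_mem_eq]
  ring

theorem radial_expansion_card {n : ℕ} (β : ℝ) (γ : ℕ → ℝ) {S S' : Finset (Fin n)}
    (h : #S = #S') : ∑ T, γ #T * chi β T S = ∑ T, γ #T * chi β T S' := by
  obtain ⟨σ, rfl⟩ : ∃ σ : Equiv.Perm (Fin n), S' = S.map σ.toEmbedding := by
    have e : {x // x ∈ S} ≃ {x // x ∈ S'} := Finset.equivOfCardEq h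
    refine ⟨e.extendSubtype, ?_⟩
    symm
    apply Finset.eq_of_subset_of_card_le
    · intro x hx
      obtain ⟨y, hy, rfl⟩ := Finset.mem_map.1 hx
      exact e.extendSubtype_mem y hy
    · rw [Finset.card_map, h]
  refine Fintype.sum_equiv (Equiv.finsetCongr σ) _ _ fun T => ?_
  simp [chi, Equiv.finsetCongr]

/-! ### The linear programming estimate for the number of neighbours -/

/-- Two words are confusable if they differ by `0` or `±1` in every coordinate. -/
def Confusable {q n : ℕ} (x y : Fin n → ZMod q) : Prop :=
  ∀ i, y i - x i = 0 ∨ y i - x i = 1 ∨ y i - x i = -1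

/-- The set of coordinates in which two words differ. -/
def diffSet {q n : ℕ} (x y : Fin n → ZMod q) : Finset (Fin n) := {i | x i ≠ y i}

theorem card_diffSet {q n : ℕ} (x y : Fin n → ZMod q) : #(diffSet x y) = hammingDist x y := rfl

/-- The indices in `I` of words confusable with `f a` at Hamming distance `d`. -/
noncomputable def neighbours {q n : ℕ} {ι : Type*} (I : Finset ι) (f : ι → Fin n → ZMod q)
    (a : ι) (d : ℕ) : Finset ι := by
  classical exact {b ∈ I | Confusable (f a) (f b) ∧ hammingDist (f a) (f b) = d}

open Classical in
/-- The kernel on words attached to a function `F` on subsets. -/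
noncomputable def kernel {q n : ℕ} (β : ℝ) (F : Finset (Fin n) → ℝ) (x y : Fin n → ZMod q) : ℝ :=
  if Confusable x y then F (diffSet x y) * (β / 2) ^ #(diffSet x y) else 0

theorem kernel_chi_mul_chi {q n : ℕ} (β : ℝ) (T U : Finset (Fin n))
    (x y : Fin n → ZMod q) :
    kernel β (fun S => chi β T S * chi β U S) x y =
      ∏ i, letter q β ((if i ∈ T then β else 1) * (if i ∈ U then β else 1))
        ((if i ∈ T then -1 else 1) * (if i ∈ U then -1 else 1)) (y i - x i) := by
  unfold kernel
  split_ifs with h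
  · have hp : (β / 2) ^ #(diffSet x y) = ∏ i, if i ∈ diffSet x y then (β / 2) else 1 := by
      rw [Finset.prod_ite_mem, Finset.univ_inter, Finset.prod_const]
    beta_reduce
    rw [hp, chi_eq_prod_univ, chi_eq_prod_univ, ← Finset.prod_mul_distrib,
      ← Finset.prod_mul_distrib]
    refine Finset.prod_congr rfl fun i _ => ?_
    have hi : i ∈ diffSet x y ↔ ¬ (y i - x i = 0) := by
      simp [diffSet, sub_eq_zero, eq_comm]
    unfold letter
    by_cases h0 : y i - x i = 0
    · have : i ∉ diffSet x y := by simp [hi, h0]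
      simp only [this, h0, if_true, if_false]
      split_ifs <;> simp
    · have h1 : i ∈ diffSet x y := hi.2 h0
      have h2 : y i - x i = 1 ∨ y i - x i = -1 := (h i).resolve_left h0
      simp only [h1, h0, h2, if_true, if_false]
  · unfold Confusable at h
    push Not at h
    obtain ⟨i, h0, h1, h2⟩ := h
    symm
    apply Finset.prod_eq_zero (Finset.mem_univ i)
    simp [letter, h0, h1, h2]

theorem sum_kernel_chi_ge {q n : ℕ} [NeZero q] (hq : 3 ≤ q) (hqo : Odd q) {β : ℝ} (hβ : 1 ≤ β)
    (hβc : β * Real.cos (Real.pi / q) ≤ 1) {ι : Type*} (I : Finset ι)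
    (f : ι → Fin n → ZMod q) (T U : Finset (Fin n)) :
    (if T = U then β ^ #T * (1 + β) ^ n else 0) * (#I : ℝ) ^ 2 ≤
      (q : ℝ) ^ n * ∑ a ∈ I, ∑ b ∈ I,
        kernel β (fun S => chi β T S * chi β U S) (f a) (f b) := by
  simp_rw [kernel_chi_mul_chi]
  have hx : ∀ k : ZMod q, -1 ≤ β * (ZMod.stdAddChar k : ℂ).re := by
    intro k
    have := neg_cos_le_stdAddChar_re hqo k
    nlinarith
  have hx' : ∀ k : ZMod q, β * (ZMod.stdAddChar k : ℂ).re ≤ β := by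
    intro k
    have := stdAddChar_re_le_one k
    nlinarith
  refine le_trans (le_of_eq ?_) (card_sq_mul_prod_le_sum_sum I f
    (fun i => letter q β ((if i ∈ T then β else 1) * (if i ∈ U then β else 1))
        ((if i ∈ T then -1 else 1) * (if i ∈ U then -1 else 1)))
    (fun i => letterHat q β ((if i ∈ T then β else 1) * (if i ∈ U then β else 1))
        ((if i ∈ T then -1 else 1) * (if i ∈ U then -1 else 1))) ?_
    (fun i z => letter_fourier hq β _ _ z))
  · congr 1
    rw [← prod_ite_eq_finset]
    refine Finset.prod_congr rfl fun i _ => ?_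
    unfold letterHat
    rw [AddChar.map_zero_eq_one, Complex.one_re]
    split_ifs <;> ring
  · intro i k
    have h1 := hx k
    have h2 := hx' k
    unfold letterHat
    split_ifs <;> nlinarith

theorem kernel_sum {q n : ℕ} (β : ℝ) {κ : Type*} (s : Finset κ) (c : κ → ℝ)
    (F : κ → Finset (Fin n) → ℝ) (x y : Fin n → ZMod q) :
    kernel β (fun S => ∑ j ∈ s, c j * F j S) x y = ∑ j ∈ s, c j * kernel β (F j) x y := by
  unfold kernel
  split_ifs with h
  · rw [Finset.sum_mul]
    refine Finset.sum_congr rfl fun j _ => by ring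
  · simp

theorem sum_kernel_expansion_ge {q n : ℕ} [NeZero q] (hq : 3 ≤ q) (hqo : Odd q) {β : ℝ}
    (hβ : 1 ≤ β) (hβc : β * Real.cos (Real.pi / q) ≤ 1) {ι : Type*} (I : Finset ι)
    (f : ι → Fin n → ZMod q) (g r : Finset (Fin n) → ℝ) (hg : ∀ T, 0 ≤ g T)
    (hr : ∀ T, 0 ≤ r T) :
    (1 + β) ^ n * (∑ T, g T * r T * β ^ #T) * (#I : ℝ) ^ 2 ≤
      (q : ℝ) ^ n * ∑ a ∈ I, ∑ b ∈ I,
        kernel β (fun S => (∑ T, g T * chi β T S) * (∑ U, r U * chi β U S)) (f a) (f b) := by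
  have hF : (fun S => (∑ T, g T * chi β T S) * (∑ U, r U * chi β U S)) =
      fun S => ∑ p : Finset (Fin n) × Finset (Fin n),
        (g p.1 * r p.2) * (chi β p.1 S * chi β p.2 S) := by
    funext S
    rw [Finset.sum_mul_sum, Fintype.sum_prod_type]
    refine Finset.sum_congr rfl fun T _ => Finset.sum_congr rfl fun U _ => by ring
  rw [hF]
  simp_rw [kernel_sum β Finset.univ (fun p : Finset (Fin n) × Finset (Fin n) => g p.1 * r p.2)
    (fun p S => chi β p.1 S * chi β p.2 S)]
  have e : (q : ℝ) ^ n * ∑ a ∈ I, ∑ b ∈ I, ∑ p : Finset (Fin n) × Finset (Fin n),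
      (g p.1 * r p.2) * kernel β (fun S => chi β p.1 S * chi β p.2 S) (f a) (f b) =
      ∑ p : Finset (Fin n) × Finset (Fin n), (g p.1 * r p.2) * ((q : ℝ) ^ n *
        ∑ a ∈ I, ∑ b ∈ I, kernel β (fun S => chi β p.1 S * chi β p.2 S) (f a) (f b)) := by
    rw [Finset.sum_congr rfl (fun a _ => Finset.sum_comm), Finset.sum_comm, Finset.mul_sum]
    refine Finset.sum_congr rfl fun p _ => ?_
    simp_rw [← Finset.mul_sum]
    ring
  rw [e]
  have e2 : (1 + β) ^ n * (∑ T, g T * r T * β ^ #T) * (#I : ℝ) ^ 2 =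
      ∑ p : Finset (Fin n) × Finset (Fin n), (g p.1 * r p.2) *
        ((if p.1 = p.2 then β ^ #p.1 * (1 + β) ^ n else 0) * (#I : ℝ) ^ 2) := by
    rw [Fintype.sum_prod_type]
    simp only [ite_mul, mul_ite, zero_mul, mul_zero, Finset.sum_ite_eq, Finset.mem_univ, if_true]
    rw [Finset.mul_sum, Finset.sum_mul]
    refine Finset.sum_congr rfl fun T _ => by ring
  rw [e2]
  refine Finset.sum_le_sum fun p _ => ?_
  exact mul_le_mul_of_nonneg_left (sum_kernel_chi_ge hq hqo hβ hβc I f p.1 p.2)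
    (mul_nonneg (hg _) (hr _))

/-- Chernoff bound for the weight of a ball in the weighted cube, in Cauchy–Schwarz form. -/
theorem sq_radial_sum_le {n : ℕ} {β x : ℝ} (hβ : 0 ≤ β) (hx0 : 0 < x) (hx1 : x ≤ 1) (γ : ℕ → ℝ)
    {t : ℕ} (hγt : ∀ k, t < k → γ k = 0) :
    (∑ T : Finset (Fin n), γ #T * β ^ #T) ^ 2 ≤
      (x⁻¹ ^ t * (1 + β * x) ^ n) * ∑ T : Finset (Fin n), γ #T ^ 2 * β ^ #T := by
  have h1 : ∀ T : Finset (Fin n), γ #T * β ^ #T =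
      (if #T ≤ t then √(β ^ #T) else 0) * (γ #T * √(β ^ #T)) := by
    intro T
    split_ifs with h
    · rw [mul_left_comm, Real.mul_self_sqrt (by positivity)]
    · rw [hγt _ (not_le.1 h)]; simp
  simp_rw [h1]
  refine (Finset.sum_mul_sq_le_sq_mul_sq _ _ _).trans ?_
  have h2 : ∀ T : Finset (Fin n), (γ #T * √(β ^ #T)) ^ 2 = γ #T ^ 2 * β ^ #T := by
    intro T
    rw [mul_pow, Real.sq_sqrt (by positivity)]
  simp_rw [h2]
  refine mul_le_mul_of_nonneg_right ?_ (Finset.sum_nonneg fun T _ => by positivity)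
  have h3 := Fintype.sum_pow_mul_eq_add_pow (Fin n) (β * x) 1
  simp only [one_pow, mul_one, Fintype.card_fin] at h3
  rw [add_comm 1, ← h3, Finset.mul_sum]
  refine Finset.sum_le_sum fun T _ => ?_
  split_ifs with h
  · rw [Real.sq_sqrt (by positivity), mul_pow, mul_left_comm]
    refine le_mul_of_one_le_right (by positivity) ?_
    rw [inv_pow, inv_mul_eq_div, one_le_div (by positivity)]
    exact pow_le_pow_of_le_one hx0.le hx1 h
  · simp; positivity

theorem chi_empty {n : ℕ} (β : ℝ) (T : Finset (Fin n)) : chi β T ∅ = β ^ #T := by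
  simp [chi]

theorem sum_kernel_radial {q n : ℕ} {ι : Type*} (I : Finset ι) (f : ι → Fin n → ZMod q)
    (β : ℝ) (L : ℕ → ℝ) (a : ι) :
    ∑ b ∈ I, kernel β (fun S => L #S) (f a) (f b) =
      ∑ d ∈ range (n + 1), #(neighbours I f a d) * (L d * (β / 2) ^ d) := by
  classical
  have h1 : ∀ b ∈ I, kernel β (fun S => L #S) (f a) (f b) =
      ∑ d ∈ range (n + 1), if Confusable (f a) (f b) ∧ hammingDist (f a) (f b) = d then
        L d * (β / 2) ^ d else 0 := by
    intro b _
    unfold kernel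
    split_ifs with h
    · simp only [h, true_and, card_diffSet]
      rw [Finset.sum_ite_eq, if_pos]
      have := hammingDist_le_card_fintype (x := f a) (y := f b)
      rw [Fintype.card_fin] at this
      exact Finset.mem_range.2 (Nat.lt_succ_of_le this)
    · simp [h]
  rw [Finset.sum_congr rfl h1, Finset.sum_comm]
  refine Finset.sum_congr rfl fun d _ => ?_
  rw [← Finset.sum_filter, Finset.sum_const, nsmul_eq_mul]
  congr 2

theorem neighbours_term_le {q n : ℕ} [NeZero q] {ι : Type*} {I : Finset ι}
    {f : ι → Fin n → ZMod q} (hf : Set.InjOn f I) {β lam : ℝ} (hβ0 : 0 < β) (hn0 : (0 : ℝ) < n)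
    (hlam : 0 ≤ lam) (Gc : ℕ → ℝ) (a : ι)
    (hcon : ∀ d : ℕ, 1 ≤ d → (1 + β) * d < β * n - lam →
      4 * β * n * q ^ n * #(neighbours I f a d) ≤ (#I : ℝ) * (n.choose d * 2 ^ d)) (d : ℕ) :
    #(neighbours I f a d) * (Gc d ^ 2 * (β * n - (1 + β) * d - lam) * (β / 2) ^ d) ≤
      (if d = 0 then β * n * Gc 0 ^ 2 else 0) +
        #I / (4 * q ^ n) * ((n.choose d : ℝ) * (β ^ d * Gc d ^ 2)) := by
  have hq0 : (0 : ℝ) < q := by exact_mod_cast Nat.pos_of_ne_zero (NeZero.ne q)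
  have hrest : 0 ≤ #I / (4 * (q : ℝ) ^ n) * ((n.choose d : ℝ) * (β ^ d * Gc d ^ 2)) := by
    positivity
  have hLle : Gc d ^ 2 * (β * n - (1 + β) * d - lam) ≤ Gc d ^ 2 * (β * n) := by
    apply mul_le_mul_of_nonneg_left _ (sq_nonneg _)
    have : 0 ≤ (1 + β) * (d : ℝ) := by positivity
    linarith
  by_cases hd : d = 0
  · subst hd
    have hc : #(neighbours I f a 0) ≤ 1 := by
      rw [Finset.card_le_one]
      intro b hb c hc
      simp only [neighbours, Finset.mem_filter, hammingDist_eq_zero] at hb hc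
      exact hf hb.1 hc.1 (hb.2.2.symm.trans hc.2.2)
    have hc' : (#(neighbours I f a 0) : ℝ) ≤ 1 := by exact_mod_cast hc
    rw [if_pos rfl, pow_zero, mul_one]
    refine le_trans ?_ (le_add_of_nonneg_right hrest)
    refine (mul_le_mul_of_nonneg_left hLle (Nat.cast_nonneg _)).trans ?_
    refine (mul_le_mul_of_nonneg_right hc' (by positivity)).trans (le_of_eq ?_)
    ring
  · rw [if_neg hd, zero_add]
    by_cases hdl : (1 + β) * d < β * n - lam
    · have h1 := hcon d (Nat.one_le_iff_ne_zero.2 hd) hdl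
      calc (#(neighbours I f a d) : ℝ) *
            (Gc d ^ 2 * (β * n - (1 + β) * d - lam) * (β / 2) ^ d)
          ≤ #(neighbours I f a d) * ((Gc d ^ 2 * (β * n)) * (β / 2) ^ d) := by gcongr
        _ = (4 * β * n * q ^ n * #(neighbours I f a d)) *
              (Gc d ^ 2 * (β / 2) ^ d / (4 * q ^ n)) := by
            field_simp
        _ ≤ (#I * (n.choose d * 2 ^ d)) * (Gc d ^ 2 * (β / 2) ^ d / (4 * q ^ n)) := by
            gcongr
        _ = #I / (4 * q ^ n) * ((n.choose d : ℝ) * (β ^ d * Gc d ^ 2)) := by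
            rw [div_pow]
            field_simp
    · refine le_trans ?_ hrest
      have : Gc d ^ 2 * (β * n - (1 + β) * d - lam) ≤ 0 :=
        mul_nonpos_of_nonneg_of_nonpos (sq_nonneg _) (by linarith)
      apply mul_nonpos_of_nonneg_of_nonpos (by positivity)
      exact mul_nonpos_of_nonpos_of_nonneg this (by positivity)

/-- Linear programming estimate: given a nonnegative approximate eigenvector `γ` of the
tridiagonal operator, supported on `[0, t]`, some word in a large code has at some distance
`d < (β n - lam) / (1 + β)` almost as many confusable neighbours as in a random code. -/
theorem exists_many_neighbours {q n : ℕ} [NeZero q] (hq : 3 ≤ q) (hqo : Odd q) {β : ℝ}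
    (hβ : 1 ≤ β) (hβc : β * Real.cos (Real.pi / q) ≤ 1) (hn : 0 < n) {γ : ℕ → ℝ} {t : ℕ}
    (hγ0 : ∀ k, 0 ≤ γ k) (hγt : ∀ k, t < k → γ k = 0) (hγpos : ∃ k ≤ n, 0 < γ k) {lam : ℝ}
    (hlam : 0 ≤ lam)
    (hγ : ∀ k ≤ n, (lam + 1) * γ k ≤
      k * γ (k - 1) + (β - 1) * k * γ k + β * (n - k) * γ (k + 1))
    {x : ℝ} (hx0 : 0 < x) (hx1 : x ≤ 1)
    {ι : Type*} {I : Finset ι} {f : ι → Fin n → ZMod q} (hf : Set.InjOn f I)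
    (hIne : I.Nonempty)
    (hI : 4 * β * n * (x⁻¹ ^ t * (1 + β * x) ^ n) * q ^ n ≤ #I * (1 + β) ^ n) :
    ∃ a ∈ I, ∃ d : ℕ, 1 ≤ d ∧ (1 + β) * d < β * n - lam ∧
      (#I : ℝ) * (n.choose d * 2 ^ d) ≤ 4 * β * n * q ^ n * #(neighbours I f a d) := by
  by_contra! hcon
  have hβ0 : 0 < β := by linarith
  have hn0 : (0 : ℝ) < n := by exact_mod_cast hn
  have hq0 : (0 : ℝ) < (q : ℝ) ^ n := by
    have : (0 : ℝ) < q := by exact_mod_cast Nat.pos_of_ne_zero (NeZero.ne q)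
    positivity
  have hI0 : (0 : ℝ) < #I := by exact_mod_cast hIne.card_pos
  set G : Finset (Fin n) → ℝ := fun S => ∑ T, γ #T * chi β T S with hG
  set r : Finset (Fin n) → ℝ := fun U =>
    (#U * γ (#U - 1) + (β - 1) * #U * γ #U + β * (n - #U) * γ (#U + 1)) - lam * γ #U with hr
  set N2 : ℝ := ∑ T : Finset (Fin n), γ #T ^ 2 * β ^ #T with hN2
  have hcard : ∀ U : Finset (Fin n), #U ≤ n := fun U => by
    simpa using Finset.card_le_univ U
  have hN2pos : 0 < N2 := by
    obtain ⟨k, hk, hkpos⟩ := hγpos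
    obtain ⟨T, -, hT⟩ := Finset.exists_subset_card_eq
      (s := (Finset.univ : Finset (Fin n))) (n := k) (by simpa using hk)
    refine Finset.sum_pos' (fun T _ => by positivity) ⟨T, Finset.mem_univ _, ?_⟩
    rw [hT]; positivity
  have hrg : ∀ U, γ #U ≤ r U := by
    intro U
    have := hγ #U (hcard U)
    simp only [hr]; linarith
  have hr0 : ∀ U, 0 ≤ r U := fun U => (hγ0 _).trans (hrg U)
  set Gc : ℕ → ℝ := fun d => G (Finset.univ.filter fun i : Fin n => i.val < d) with hGc
  have hGG : ∀ S, G S = Gc #S := by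
    intro S
    apply radial_expansion_card
    have := hcard S
    rw [Fin.card_filter_val_lt, Nat.min_eq_right this]
  set L : ℕ → ℝ := fun d => Gc d ^ 2 * (β * n - (1 + β) * d - lam) with hL
  have hF : (fun S => (∑ T, γ #T * chi β T S) * (∑ U, r U * chi β U S)) =
      fun S => L #S := by
    funext S
    have h1 := linear_mul_radial_expansion β γ S
    have h2 : ∑ U, r U * chi β U S = (β * n - (1 + β) * #S) * G S - lam * G S := by
      simp only [hG]
      rw [h1, Finset.mul_sum, ← Finset.sum_sub_distrib]
      refine Finset.sum_congr rfl fun U _ => by simp only [hr]; ring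
    rw [h2]
    change G S * _ = _
    rw [hGG S]
    simp only [hL]; ring
  have hlow := sum_kernel_expansion_ge hq hqo hβ hβc I f (fun T => γ #T) r (fun T => hγ0 _) hr0
  rw [hF] at hlow
  have hN2r : N2 ≤ ∑ T : Finset (Fin n), γ #T * r T * β ^ #T := by
    refine Finset.sum_le_sum fun T _ => ?_
    rw [sq]
    have := hrg T
    have := hγ0 #T
    gcongr
  have hGc0 : Gc 0 ^ 2 ≤ (x⁻¹ ^ t * (1 + β * x) ^ n) * N2 := by
    have : Gc 0 = ∑ T : Finset (Fin n), γ #T * β ^ #T := by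
      have h := hGG ∅
      rw [Finset.card_empty] at h
      rw [← h]
      simp only [hG, chi_empty]
    rw [this]
    exact sq_radial_sum_le hβ0.le hx0 hx1 γ hγt
  have hpars : ∑ d ∈ range (n + 1), (n.choose d : ℝ) * (β ^ d * Gc d ^ 2) =
      (1 + β) ^ n * N2 := by
    have h1 := sum_mul_expansion_mul_expansion (n := n) β (fun T => γ #T) (fun T => γ #T)
    have h2 := Finset.sum_powerset_apply_card (fun d => β ^ d * Gc d ^ 2)
      (x := (Finset.univ : Finset (Fin n)))
    simp only [Finset.powerset_univ, Finset.card_univ, Fintype.card_fin, nsmul_eq_mul] at h2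
    rw [← h2]
    have h3 : ∀ S : Finset (Fin n), β ^ #S * Gc #S ^ 2 =
        β ^ #S * ((∑ T, γ #T * chi β T S) * (∑ U, γ #U * chi β U S)) := by
      intro S
      rw [← hGG S, sq]
    simp_rw [h3]
    rw [h1]
    congr 1
    refine Finset.sum_congr rfl fun T _ => by ring
  have hrow : ∀ a ∈ I, ∑ b ∈ I, kernel β (fun S => L #S) (f a) (f b) ≤
      β * n * Gc 0 ^ 2 + #I / (4 * q ^ n) * ((1 + β) ^ n * N2) := by
    intro a ha
    rw [sum_kernel_radial]
    refine (Finset.sum_le_sum fun d _ => neighbours_term_le hf hβ0 hn0 hlam Gc a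
      (fun d h1 h2 => (hcon a ha d h1 h2).le) d).trans (le_of_eq ?_)
    rw [Finset.sum_add_distrib, ← Finset.mul_sum, hpars]
    simp
  clear_value L Gc N2
  clear hrg hr0 hF hGG hL hcon
  clear_value r G
  have hself : β * n * Gc 0 ^ 2 ≤ #I / (4 * q ^ n) * ((1 + β) ^ n * N2) := by
    calc β * n * Gc 0 ^ 2 ≤ β * n * ((x⁻¹ ^ t * (1 + β * x) ^ n) * N2) := by gcongr
      _ = (4 * β * n * (x⁻¹ ^ t * (1 + β * x) ^ n) * q ^ n) * (N2 / (4 * q ^ n)) := by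
          field_simp
      _ ≤ (#I * (1 + β) ^ n) * (N2 / (4 * q ^ n)) := by gcongr
      _ = #I / (4 * q ^ n) * ((1 + β) ^ n * N2) := by ring
  have hup : (q : ℝ) ^ n * ∑ a ∈ I, ∑ b ∈ I, kernel β (fun S => L #S) (f a) (f b) ≤
      (1 + β) ^ n * N2 * (#I : ℝ) ^ 2 / 2 := by
    calc (q : ℝ) ^ n * ∑ a ∈ I, ∑ b ∈ I, kernel β (fun S => L #S) (f a) (f b)
        ≤ (q : ℝ) ^ n * ∑ a ∈ I, (2 * (#I / (4 * q ^ n) * ((1 + β) ^ n * N2))) := by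
          gcongr with a ha
          have := hrow a ha
          linarith
      _ = (1 + β) ^ n * N2 * (#I : ℝ) ^ 2 / 2 := by
          rw [Finset.sum_const, nsmul_eq_mul]
          field_simp
          norm_num
  have hpos : 0 < (1 + β) ^ n * N2 * (#I : ℝ) ^ 2 := by positivity
  have hge : (1 + β) ^ n * N2 * (#I : ℝ) ^ 2 ≤
      (1 + β) ^ n * (∑ T : Finset (Fin n), γ #T * r T * β ^ #T) * (#I : ℝ) ^ 2 := by
    gcongr
  linarith

/-- A windowed sine wave is an exact sub-eigenvector of the tridiagonal operator. -/
theorem exists_radial_subeigenvector {β : ℝ} (hβ : 1 ≤ β) {n m k₀ : ℕ} (hm : 1 ≤ m)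
    (hk₀ : 1 ≤ k₀) (hn : k₀ + m < n) :
    ∃ γ : ℕ → ℝ, (∀ k, 0 ≤ γ k) ∧ (∀ k, k₀ + m < k → γ k = 0) ∧ (∃ k ≤ n, 0 < γ k) ∧
      ∀ k ≤ n, ((β - 1) * k₀ + 2 * Real.cos (Real.pi / (m + 1)) *
          √(β * k₀ * (n - (k₀ + m)))) * γ k ≤
        k * γ (k - 1) + (β - 1) * k * γ k + β * (n - k) * γ (k + 1) := by
  have hβ0 : 0 < β := by linarith
  set b : ℝ := β * (n - (k₀ + m)) with hb
  have hnr : ((k₀ : ℝ) + m) < n := by exact_mod_cast hn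
  have hk₀r : (0 : ℝ) < k₀ := by exact_mod_cast hk₀
  have hb0 : 0 < b := mul_pos hβ0 (by linarith)
  set r : ℝ := √(k₀ / b) with hr
  have hr0 : 0 < r := Real.sqrt_pos.2 (by positivity)
  have hroot : √(β * k₀ * (n - (k₀ + m))) = b * r := by
    rw [hr, ← Real.sqrt_sq hb0.le, ← Real.sqrt_mul (by positivity), Real.sqrt_sq hb0.le]
    congr 1
    rw [sq, mul_assoc b b, mul_div_cancel₀ _ hb0.ne', hb]
    ring
  have hbr : b * r ^ 2 = k₀ := by
    rw [hr, Real.sq_sqrt (by positivity), mul_div_cancel₀ _ hb0.ne']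
  have hm0 : (0 : ℝ) < (m : ℝ) + 1 := by positivity
  set ω : ℝ := Real.pi / (m + 1) with hω
  have hω0 : 0 < ω := by rw [hω]; exact div_pos Real.pi_pos hm0
  have hωm : ω * (m + 1) = Real.pi := by rw [hω]; field_simp
  set γ : ℕ → ℝ := fun k => if k₀ ≤ k ∧ k ≤ k₀ + m + 1 then
    r ^ k * Real.sin (ω * (k - k₀)) else 0 with hγ
  have hin : ∀ k, k₀ ≤ k → k ≤ k₀ + m + 1 → γ k = r ^ k * Real.sin (ω * (k - k₀)) :=
    fun k h1 h2 => by simp only [hγ]; rw [if_pos ⟨h1, h2⟩]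
  have hlast : γ (k₀ + m + 1) = 0 := by
    rw [hin _ (by omega) le_rfl]
    push_cast
    have : ω * ((k₀ : ℝ) + m + 1 - k₀) = Real.pi := by rw [← hωm]; ring
    rw [this, Real.sin_pi, mul_zero]
  have hfirst : γ k₀ = 0 := by
    rw [hin _ le_rfl (by omega)]; simp
  have hnn : ∀ k, 0 ≤ γ k := by
    intro k
    by_cases h : k₀ ≤ k ∧ k ≤ k₀ + m + 1
    · rw [hin k h.1 h.2]
      have h1 : (k₀ : ℝ) ≤ k := by exact_mod_cast h.1
      have h2 : (k : ℝ) ≤ k₀ + m + 1 := by exact_mod_cast h.2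
      apply mul_nonneg (by positivity)
      apply Real.sin_nonneg_of_nonneg_of_le_pi
      · exact mul_nonneg hω0.le (by linarith)
      · rw [← hωm]
        exact mul_le_mul_of_nonneg_left (by linarith) hω0.le
    · simp only [hγ]; rw [if_neg h]
  have hzero : ∀ k, k ≤ k₀ ∨ k₀ + m < k → γ k = 0 := by
    intro k hk
    by_cases h1 : k = k₀
    · rw [h1, hfirst]
    by_cases h2 : k = k₀ + m + 1
    · rw [h2, hlast]
    simp only [hγ]
    rw [if_neg (by omega)]
  refine ⟨γ, hnn, fun k hk => hzero k (Or.inr hk), ⟨k₀ + 1, by omega, ?_⟩, ?_⟩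
  · rw [hin _ (by omega) (by omega)]
    apply mul_pos (by positivity)
    push_cast
    apply Real.sin_pos_of_pos_of_lt_pi
    · rw [add_sub_cancel_left, mul_one]; exact hω0
    · rw [add_sub_cancel_left, mul_one, ← hωm]
      have : (1 : ℝ) ≤ m := by exact_mod_cast hm
      nlinarith
  · intro k hk
    have hkn : (k : ℝ) ≤ n := by exact_mod_cast hk
    by_cases hout : k ≤ k₀ ∨ k₀ + m < k
    · rw [hzero k hout, mul_zero, mul_zero, add_zero]
      have h1 := hnn (k - 1)
      have h2 := hnn (k + 1)
      have h3 : (0 : ℝ) ≤ n - k := by linarith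
      positivity
    · push Not at hout
      obtain ⟨j, rfl⟩ : ∃ j, k = j + 1 := ⟨k - 1, by omega⟩
      have hk1 : (k₀ : ℝ) ≤ ((j + 1 : ℕ) : ℝ) := by exact_mod_cast hout.1.le
      have hk2 : ((j + 1 : ℕ) : ℝ) ≤ k₀ + m := by exact_mod_cast hout.2
      have g0 := hnn j
      have g1 := hnn (j + 1)
      have g2 := hnn (j + 1 + 1)
      have e0 := hin j (by omega) (by omega)
      have e1 := hin (j + 1) (by omega) (by omega)
      have e2 := hin (j + 1 + 1) (by omega) (by omega)
      have hrec : k₀ * γ j + b * γ (j + 1 + 1) =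
          2 * Real.cos ω * (b * r) * γ (j + 1) := by
        rw [e0, e1, e2]
        have a0 : ω * ((j : ℝ) - k₀) = ω * (((j + 1 : ℕ) : ℝ) - k₀) - ω := by push_cast; ring
        have a2 : ω * (((j + 1 + 1 : ℕ) : ℝ) - k₀) = ω * (((j + 1 : ℕ) : ℝ) - k₀) + ω := by
          push_cast; ring
        rw [a0, a2, Real.sin_sub, Real.sin_add]
        linear_combination (-(r ^ j * (Real.sin (ω * (((j + 1 : ℕ) : ℝ) - k₀)) * Real.cos ω -
          Real.cos (ω * (((j + 1 : ℕ) : ℝ) - k₀)) * Real.sin ω))) * hbr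
      rw [hroot, Nat.add_sub_cancel]
      calc ((β - 1) * k₀ + 2 * Real.cos ω * (b * r)) * γ (j + 1)
          = k₀ * γ j + (β - 1) * k₀ * γ (j + 1) + b * γ (j + 1 + 1) := by linarith
        _ ≤ _ := by
          have hβ1 : 0 ≤ β - 1 := by linarith
          have hb' : b ≤ β * (n - ((j + 1 : ℕ) : ℝ)) := by
            rw [hb]; exact mul_le_mul_of_nonneg_left (by linarith) hβ0.le
          gcongr

/-! ### Overlaps of output sets -/

/-- The outputs reachable from the input word `x`. -/
def outputs {q n : ℕ} (x : Fin n → ZMod q) : Finset (Fin n → ZMod q) :=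
  Fintype.piFinset fun i => {x i, x i + 1}

theorem mem_outputs {q n : ℕ} {x y : Fin n → ZMod q} :
    y ∈ outputs x ↔ ∀ i, y i = x i ∨ y i = x i + 1 := by
  simp [outputs]

theorem Wn_half {q n : ℕ} [NeZero q] (y x : Fin n → ZMod q) :
    Wn q n (1 / 2) y x = if y ∈ outputs x then (1 / 2) ^ n else 0 := by
  unfold Wn
  split_ifs with h
  · rw [mem_outputs] at h
    have : ∀ i, W q (1 / 2) (y i) (x i) = 1 / 2 := by
      intro i
      unfold W
      rcases h i with hi | hi
      · rw [if_pos hi]; norm_num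
      · split_ifs <;> norm_num
    rw [Finset.prod_congr rfl fun i _ => this i]
    simp
  · rw [mem_outputs] at h
    push Not at h
    obtain ⟨i, h1, h2⟩ := h
    apply Finset.prod_eq_zero (Finset.mem_univ i)
    simp [W, h1, h2]

theorem card_pair {q : ℕ} (hq : 3 ≤ q) (a : ZMod q) : #({a, a + 1} : Finset (ZMod q)) = 2 := by
  have : Fact (1 < q) := ⟨by omega⟩
  apply Finset.card_pair
  simp

theorem card_inter_pair_le_one {q : ℕ} (hq : 3 ≤ q) {a b : ZMod q} (h : a ≠ b) :
    #(({a, a + 1} : Finset (ZMod q)) ∩ {b, b + 1}) ≤ 1 := by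
  rw [Finset.card_le_one]
  have : Fact (2 < q) := ⟨by omega⟩
  have h11 : (-1 : ZMod q) ≠ 1 := ZMod.neg_one_ne_one
  intro u hu v hv
  simp only [Finset.mem_inter, Finset.mem_insert, Finset.mem_singleton] at hu hv
  have key : ¬ (a = b + 1 ∧ b = a + 1) := by
    rintro ⟨h1, h2⟩
    apply h11
    linear_combination h1 + h2
  grind

theorem two_pow_hammingDist {q n : ℕ} (x y : Fin n → ZMod q) :
    2 ^ hammingDist x y = ∏ i, if x i ≠ y i then 2 else 1 := by
  rw [Finset.prod_ite, Finset.prod_const, Finset.prod_const_one, mul_one]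
  rfl

theorem outputs_inter {q n : ℕ} (x y : Fin n → ZMod q) :
    outputs x ∩ outputs y =
      Fintype.piFinset fun i => ({x i, x i + 1} : Finset (ZMod q)) ∩ {y i, y i + 1} := by
  ext u
  simp only [Finset.mem_inter, outputs, Fintype.mem_piFinset]
  exact forall_and.symm

theorem card_outputs_inter {q n : ℕ} (hq : 3 ≤ q) {x y : Fin n → ZMod q} (h : Confusable x y) :
    #(outputs x ∩ outputs y) * 2 ^ hammingDist x y = 2 ^ n := by
  rw [outputs_inter, Fintype.card_piFinset, two_pow_hammingDist, ← Finset.prod_mul_distrib]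
  have : (2 : ℕ) ^ n = ∏ _i : Fin n, 2 := by simp
  rw [this]
  refine Finset.prod_congr rfl fun i _ => ?_
  split_ifs with hi
  · have h1 : #(({x i, x i + 1} : Finset (ZMod q)) ∩ {y i, y i + 1}) = 1 := by
      apply le_antisymm (card_inter_pair_le_one hq hi)
      rw [Nat.one_le_iff_ne_zero, Finset.card_ne_zero]
      rcases h i with h0 | h0 | h0
      · exact absurd (sub_eq_zero.1 h0).symm hi
      · refine ⟨y i, ?_⟩
        rw [sub_eq_iff_eq_add] at h0
        simp [h0, add_comm]
      · refine ⟨x i, ?_⟩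
        rw [sub_eq_iff_eq_add] at h0
        simp [h0]
    rw [h1, one_mul]
  · push Not at hi
    rw [hi, Finset.inter_self, card_pair hq, mul_one]

theorem outputs_inter_eq_empty {q n : ℕ} {x y : Fin n → ZMod q} (h : ¬ Confusable x y) :
    outputs x ∩ outputs y = ∅ := by
  rw [Finset.eq_empty_iff_forall_notMem]
  intro u hu
  rw [Finset.mem_inter, mem_outputs, mem_outputs] at hu
  apply h
  intro i
  have h1 := hu.1 i
  have h2 := hu.2 i
  grind

theorem card_triple_letter {q : ℕ} (hq : 3 ≤ q) (a b c : ZMod q) :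
    #(({a, a + 1} : Finset (ZMod q)) ∩ {b, b + 1} ∩ {c, c + 1}) ^ 2 *
      ((if a ≠ b then 2 else 1) * (if a ≠ c then 2 else 1) * (if b ≠ c then 2 else 1)) ≤ 4 := by
  by_cases hab : a = b
  · subst hab
    rw [Finset.inter_self]
    by_cases hac : a = c
    · subst hac
      rw [Finset.inter_self, card_pair hq]
      simp
    · have h1 := card_inter_pair_le_one hq hac
      simp only [hac, ne_eq, not_true, not_false_iff, if_true, if_false]
      nlinarith
  · by_cases hac : a = c
    · subst hac
      have h1 := card_inter_pair_le_one hq hab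
      rw [Finset.inter_right_comm, Finset.inter_self]
      simp only [hab, Ne.symm hab, ne_eq, not_true, not_false_iff, if_true, if_false]
      nlinarith
    · by_cases hbc : b = c
      · subst hbc
        have h1 := card_inter_pair_le_one hq hab
        rw [Finset.inter_assoc, Finset.inter_self]
        simp only [hab, ne_eq, not_true, not_false_iff, if_true, if_false]
        nlinarith
      · have : ({a, a + 1} : Finset (ZMod q)) ∩ {b, b + 1} ∩ {c, c + 1} = ∅ := by
          rw [Finset.eq_empty_iff_forall_notMem]
          intro u hu
          simp only [Finset.mem_inter, Finset.mem_insert, Finset.mem_singleton] at hu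
          grind
        rw [this]
        simp

theorem card_outputs_inter_inter {q n : ℕ} (hq : 3 ≤ q) (x y z : Fin n → ZMod q) :
    #(outputs x ∩ outputs y ∩ outputs z) ^ 2 *
      2 ^ (hammingDist x y + hammingDist x z + hammingDist y z) ≤ 4 ^ n := by
  have h1 : outputs x ∩ outputs y ∩ outputs z = Fintype.piFinset fun i =>
      ({x i, x i + 1} : Finset (ZMod q)) ∩ {y i, y i + 1} ∩ {z i, z i + 1} := by
    rw [outputs_inter]
    ext u
    simp only [Finset.mem_inter, outputs, Fintype.mem_piFinset]
    exact forall_and.symm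
  rw [h1, Fintype.card_piFinset, pow_add, pow_add, two_pow_hammingDist, two_pow_hammingDist,
    two_pow_hammingDist, ← Finset.prod_pow, ← Finset.prod_mul_distrib, ← Finset.prod_mul_distrib,
    ← Finset.prod_mul_distrib]
  have : (4 : ℕ) ^ n = ∏ _i : Fin n, 4 := by simp
  rw [this]
  exact Finset.prod_le_prod' fun i _ => card_triple_letter hq _ _ _

theorem two_mul_sum_card_sub_le_card_biUnion {ι α : Type*} [DecidableEq α] (J : Finset ι)
    (A : ι → Finset α) :
    2 * ∑ b ∈ J, (#(A b) : ℝ) - ∑ b ∈ J, ∑ c ∈ J, (#(A b ∩ A c) : ℝ) ≤ #(J.biUnion A) := by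
  have h1 : ∀ B ⊆ J.biUnion A, (#B : ℝ) = ∑ y ∈ J.biUnion A, if y ∈ B then (1 : ℝ) else 0 := by
    intro B hB
    rw [← Finset.sum_filter, Finset.filter_mem_eq_inter, Finset.inter_eq_right.2 hB]
    simp only [Finset.sum_const, nsmul_eq_mul, mul_one]
  have hA : ∀ b ∈ J, A b ⊆ J.biUnion A := fun b hb => Finset.subset_biUnion_of_mem A hb
  have h2 : ∑ b ∈ J, (#(A b) : ℝ) =
      ∑ y ∈ J.biUnion A, ∑ b ∈ J, if y ∈ A b then (1 : ℝ) else 0 := by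
    rw [Finset.sum_comm]
    exact Finset.sum_congr rfl fun b hb => h1 (A b) (hA b hb)
  have h3 : ∑ b ∈ J, ∑ c ∈ J, (#(A b ∩ A c) : ℝ) =
      ∑ y ∈ J.biUnion A, (∑ b ∈ J, if y ∈ A b then (1 : ℝ) else 0) ^ 2 := by
    have : ∀ y, (∑ b ∈ J, if y ∈ A b then (1 : ℝ) else 0) ^ 2 =
        ∑ b ∈ J, ∑ c ∈ J, if y ∈ A b ∩ A c then (1 : ℝ) else 0 := by
      intro y
      rw [sq, Finset.sum_mul_sum]
      refine Finset.sum_congr rfl fun b _ => Finset.sum_congr rfl fun c _ => ?_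
      by_cases hb : y ∈ A b <;> by_cases hc : y ∈ A c <;> simp [hb, hc]
    rw [Finset.sum_congr rfl fun y _ => this y, Finset.sum_comm (s := J.biUnion A)]
    refine Finset.sum_congr rfl fun b hb => ?_
    rw [Finset.sum_comm (s := J.biUnion A)]
    exact Finset.sum_congr rfl fun c _ => h1 (A b ∩ A c) (Finset.inter_subset_left.trans (hA b hb))
  rw [h2, h3, Finset.mul_sum, ← Finset.sum_sub_distrib, Finset.card_eq_sum_ones]
  push_cast
  refine Finset.sum_le_sum fun y _ => ?_
  nlinarith [sq_nonneg ((∑ b ∈ J, if y ∈ A b then (1 : ℝ) else 0) - 1)]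

/-! ### From confusable neighbours to decoding errors -/

/-- The outputs of the codeword `m` that another codeword could have produced as well. -/
def clash {q n M : ℕ} (f : Fin M → Fin n → ZMod q) (m : Fin M) : Finset (Fin n → ZMod q) :=
  {y ∈ outputs (f m) | ∃ m', m' ≠ m ∧ y ∈ outputs (f m')}

theorem sum_card_clash_le {q n M : ℕ} [NeZero q] (f : Fin M → Fin n → ZMod q)
    (φ : (Fin n → ZMod q) → Fin M) :
    ∑ m, #(clash f m) ≤ 2 * ∑ m, #{y ∈ outputs (f m) | φ y ≠ m} := by
  have h1 : ∀ B : Fin M → Finset (Fin n → ZMod q), ∑ m, #(B m) = ∑ y, #{m | y ∈ B m} := by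
    intro B
    simp_rw [Finset.card_filter]
    rw [Finset.sum_comm]
    refine Finset.sum_congr rfl fun m _ => ?_
    rw [← Finset.card_filter, Finset.filter_univ_mem]
  rw [h1, h1, Finset.mul_sum]
  refine Finset.sum_le_sum fun y _ => ?_
  set A : Finset (Fin M) := {m | y ∈ ({y ∈ outputs (f m) | φ y ≠ m} : Finset _)} with hA
  have memA : ∀ m, m ∈ A ↔ y ∈ outputs (f m) ∧ φ y ≠ m := by
    intro m; simp [hA]
  rcases ({m | y ∈ clash f m} : Finset (Fin M)).eq_empty_or_nonempty with h | ⟨m, hm⟩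
  · rw [h]; simp
  · have hsub : ({m | y ∈ clash f m} : Finset (Fin M)) ⊆ insert (φ y) A := by
      intro k hk
      simp only [clash, Finset.mem_filter, Finset.mem_univ, true_and] at hk
      rw [Finset.mem_insert, memA]
      by_cases h : φ y = k
      · exact Or.inl h.symm
      · exact Or.inr ⟨hk.1, h⟩
    have hne : A.Nonempty := by
      simp only [clash, Finset.mem_filter, Finset.mem_univ, true_and] at hm
      obtain ⟨hm1, m', hm', hm2⟩ := hm
      by_cases h : φ y = m
      · exact ⟨m', (memA m').2 ⟨hm2, fun h' => hm' (h'.symm.trans h)⟩⟩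
      · exact ⟨m, (memA m).2 ⟨hm1, h⟩⟩
    have h2 := (Finset.card_le_card hsub).trans (Finset.card_insert_le _ _)
    have h3 := hne.card_pos
    omega

/-- Clashing outputs bound the average error probability over the half-noise channel from below. -/
theorem sum_card_clash_le_error {q n M : ℕ} [NeZero q] (f : Fin M → Fin n → ZMod q)
    (φ : (Fin n → ZMod q) → Fin M) :
    (1 / M) * ((∑ m, #(clash f m) : ℕ) / 2 ^ n / 2 : ℝ) ≤
      (1 / M) * ∑ m : Fin M, ∑ y : Fin n → ZMod q,
        if φ y = m then 0 else Wn q n (1 / 2) y (f m) := by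
  have h1 : ∀ m, (∑ y : Fin n → ZMod q, if φ y = m then 0 else Wn q n (1 / 2) y (f m)) =
      #{y ∈ outputs (f m) | φ y ≠ m} / 2 ^ n := by
    intro m
    have : ∀ y, (if φ y = m then 0 else Wn q n (1 / 2) y (f m)) =
        if y ∈ ({y ∈ outputs (f m) | φ y ≠ m} : Finset _) then ((1 : ℝ) / 2) ^ n else 0 := by
      intro y
      rw [Wn_half]
      by_cases h1 : φ y = m <;> by_cases h2 : y ∈ outputs (f m) <;> simp [h1, h2]
    rw [Finset.sum_congr rfl fun y _ => this y, ← Finset.sum_filter, Finset.filter_univ_mem,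
      Finset.sum_const, nsmul_eq_mul, one_div, inv_pow, div_eq_mul_inv]
  rw [Finset.sum_congr rfl fun m _ => h1 m, ← Finset.sum_div]
  have h2 : ((∑ m, #(clash f m) : ℕ) : ℝ) ≤ 2 * ∑ m, (#{y ∈ outputs (f m) | φ y ≠ m} : ℝ) := by
    exact_mod_cast sum_card_clash_le f φ
  rw [div_right_comm]
  refine mul_le_mul_of_nonneg_left (div_le_div_of_nonneg_right ?_ (by positivity)) (by positivity)
  linarith

theorem le_card_clash_of_close {q n M : ℕ} (hq : 3 ≤ q) (f : Fin M → Fin n → ZMod q)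
    {m m' : Fin M} (hne : m' ≠ m) (hc : Confusable (f m) (f m')) {e : ℕ}
    (he : hammingDist (f m) (f m') ≤ e) : (2 : ℝ) ^ n / 2 ^ e ≤ #(clash f m) := by
  have h1 : outputs (f m) ∩ outputs (f m') ⊆ clash f m := by
    intro y hy
    rw [Finset.mem_inter] at hy
    exact Finset.mem_filter.2 ⟨hy.1, m', hne, hy.2⟩
  have h2 : (#(outputs (f m) ∩ outputs (f m')) : ℝ) * 2 ^ hammingDist (f m) (f m') = 2 ^ n := by
    exact_mod_cast card_outputs_inter hq hc
  rw [div_le_iff₀ (by positivity), ← h2]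
  have h3 : (#(outputs (f m) ∩ outputs (f m')) : ℝ) ≤ #(clash f m) := by
    exact_mod_cast Finset.card_le_card h1
  gcongr
  norm_num

theorem le_card_clash_of_neighbours {q n M : ℕ} (hq : 3 ≤ q) (f : Fin M → Fin n → ZMod q)
    {I : Finset (Fin M)} {m : Fin M} {d D : ℕ} (hD : 1 ≤ D) (hd : 1 ≤ d)
    (hI : ∀ b ∈ I, ∀ c, c ≠ b → Confusable (f b) (f c) → 2 * D < hammingDist (f b) (f c)) :
    min (#(neighbours I f m d) : ℝ) (2 ^ (D - 1)) / 2 ^ d * 2 ^ n / 2 ≤ #(clash f m) := by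
  obtain ⟨J, hJN, hJ⟩ := Finset.exists_subset_card_eq
    (min_le_left #(neighbours I f m d) (2 ^ (D - 1)))
  have hmem : ∀ b ∈ J, b ∈ I ∧ Confusable (f m) (f b) ∧ hammingDist (f m) (f b) = d := by
    intro b hb
    have := hJN hb
    simpa only [neighbours, Finset.mem_filter] using this
  set A : Fin M → Finset (Fin n → ZMod q) := fun b => outputs (f m) ∩ outputs (f b) with hA
  set P : ℝ := 2 ^ n / 2 ^ d with hP
  have hP0 : 0 < P := by positivity
  have hAb : ∀ b ∈ J, (#(A b) : ℝ) = P := by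
    intro b hb
    rw [hP, eq_div_iff (by positivity)]
    have := card_outputs_inter hq (hmem b hb).2.1
    rw [(hmem b hb).2.2] at this
    exact_mod_cast this
  have hAbc : ∀ b ∈ J, ∀ c ∈ J, c ≠ b → (#(A b ∩ A c) : ℝ) ≤ P / 2 ^ D := by
    intro b hb c hc hne
    have heq : A b ∩ A c = outputs (f m) ∩ outputs (f b) ∩ outputs (f c) := by
      ext y; simp only [hA, Finset.mem_inter]; tauto
    by_cases hcf : Confusable (f b) (f c)
    · have h1 := card_outputs_inter_inter hq (f m) (f b) (f c)
      have h2 := hI b (hmem b hb).1 c hne hcf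
      rw [← heq, (hmem b hb).2.2, (hmem c hc).2.2] at h1
      have h3 : #(A b ∩ A c) ^ 2 * 2 ^ (d + d + 2 * D) ≤ 4 ^ n :=
        le_trans (Nat.mul_le_mul_left _ (Nat.pow_le_pow_right (by norm_num) (by omega))) h1
      have h4 : (#(A b ∩ A c) * 2 ^ (d + D)) ^ 2 ≤ (2 ^ n) ^ 2 := by
        calc (#(A b ∩ A c) * 2 ^ (d + D)) ^ 2 = #(A b ∩ A c) ^ 2 * 2 ^ (d + d + 2 * D) := by ring
          _ ≤ 4 ^ n := h3
          _ = (2 ^ n) ^ 2 := by rw [← pow_mul, mul_comm, pow_mul]; norm_num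
      have h5 : #(A b ∩ A c) * 2 ^ (d + D) ≤ 2 ^ n :=
        (Nat.pow_le_pow_iff_left (by norm_num)).1 h4
      rw [hP, div_div, ← pow_add, le_div_iff₀ (by positivity)]
      exact_mod_cast h5
    · rw [heq, Finset.inter_assoc, outputs_inter_eq_empty hcf, Finset.inter_empty,
        Finset.card_empty, Nat.cast_zero]
      positivity
  have hsub : J.biUnion A ⊆ clash f m := by
    intro y hy
    obtain ⟨b, hb, hyb⟩ := Finset.mem_biUnion.1 hy
    rw [hA, Finset.mem_inter] at hyb
    refine Finset.mem_filter.2 ⟨hyb.1, b, ?_, hyb.2⟩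
    rintro rfl
    have := (hmem _ hb).2.2
    rw [hammingDist_self] at this
    omega
  have hJle : (#J : ℝ) ≤ 2 ^ D / 2 := by
    have h1 : #J ≤ 2 ^ (D - 1) := hJ ▸ min_le_right _ _
    have h2 : (2 : ℝ) ^ D = 2 * 2 ^ (D - 1) := by
      rw [← pow_succ']; congr 1; omega
    rw [h2, mul_div_cancel_left₀ _ (by norm_num)]
    exact_mod_cast h1
  have hsum : ∑ b ∈ J, ∑ c ∈ J, (#(A b ∩ A c) : ℝ) ≤ #J * (P + P / 2) := by
    rw [← nsmul_eq_mul]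
    refine Finset.sum_le_card_nsmul _ _ _ fun b hb => ?_
    rw [← Finset.add_sum_erase _ _ hb, Finset.inter_self, hAb b hb]
    have h1 : ∑ c ∈ J.erase b, (#(A b ∩ A c) : ℝ) ≤ #(J.erase b) • (P / 2 ^ D) :=
      Finset.sum_le_card_nsmul _ _ _ fun c hc =>
        hAbc b hb c (Finset.mem_of_mem_erase hc) (Finset.ne_of_mem_erase hc)
    have h2 : (#(J.erase b) : ℝ) ≤ 2 ^ D / 2 :=
      le_trans (by exact_mod_cast Finset.card_le_card (Finset.erase_subset _ _)) hJle
    rw [nsmul_eq_mul] at h1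
    have h3 : (#(J.erase b) : ℝ) * (P / 2 ^ D) ≤ 2 ^ D / 2 * (P / 2 ^ D) :=
      mul_le_mul_of_nonneg_right h2 (by positivity)
    have h4 : (2 : ℝ) ^ D / 2 * (P / 2 ^ D) = P / 2 := by field_simp
    linarith
  have hfin := two_mul_sum_card_sub_le_card_biUnion J A
  rw [Finset.sum_congr rfl hAb, Finset.sum_const, nsmul_eq_mul] at hfin
  have hcard : (#(J.biUnion A) : ℝ) ≤ #(clash f m) := by
    exact_mod_cast Finset.card_le_card hsub
  have hmin : min (#(neighbours I f m d) : ℝ) (2 ^ (D - 1)) = #J := by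
    rw [hJ]; push_cast; rfl
  calc min (#(neighbours I f m d) : ℝ) (2 ^ (D - 1)) / 2 ^ d * 2 ^ n / 2 = #J * P / 2 := by
        rw [hmin, hP]; ring
    _ ≤ _ := by linarith

/-- A lower bound on the error probability at a fixed block length: either the code has many pairs at
distance at most `2 * D`, or many codewords have many confusable neighbours at a common distance. -/
theorem error_lower_bound {q n M : ℕ} [NeZero q] (hq : 3 ≤ q) (hqo : Odd q) {β : ℝ} (hβ : 1 ≤ β)
    (hβc : β * Real.cos (Real.pi / q) ≤ 1) (hn : 0 < n) {γ : ℕ → ℝ} {t : ℕ}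
    (hγ0 : ∀ k, 0 ≤ γ k) (hγt : ∀ k, t < k → γ k = 0) (hγpos : ∃ k ≤ n, 0 < γ k) {lam : ℝ}
    (hlam : 0 ≤ lam)
    (hγ : ∀ k ≤ n, (lam + 1) * γ k ≤
      k * γ (k - 1) + (β - 1) * k * γ k + β * (n - k) * γ (k + 1))
    {x : ℝ} (hx0 : 0 < x) (hx1 : x ≤ 1) (hM : 0 < M)
    (hMx : 4 * β * n * (x⁻¹ ^ t * (1 + β * x) ^ n) * q ^ n ≤ M / 4 * (1 + β) ^ n)
    {D : ℕ} (hD : 1 ≤ D) (f : Fin M → Fin n → ZMod q) (φ : (Fin n → ZMod q) → Fin M) {E : ℝ}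
    (hE : E = (1 / M) * ∑ m : Fin M, ∑ y : Fin n → ZMod q,
        if φ y = m then 0 else Wn q n (1 / 2) y (f m)) :
    1 / 2 ^ (2 * D) / 4 ≤ E ∨ ∃ d : ℕ, 2 * D < d ∧ (1 + β) * d < β * n - lam ∧
      (M * (n.choose d * 2 ^ d) / (16 * β * n * q ^ n) / 2 ^ d / 16 ≤ E ∨
        (2 : ℝ) ^ (D - 1) / 2 ^ d / 16 ≤ E) := by
  classical
  have hβ0 : 0 < β := by linarith
  have hMr : (0 : ℝ) < M := by exact_mod_cast hM
  have hnr : (0 : ℝ) < n := by exact_mod_cast hn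
  have hqr : (0 : ℝ) < q := by exact_mod_cast (by omega : 0 < q)
  have hEc := sum_card_clash_le_error f φ
  rw [← hE] at hEc
  have key : ∀ (S : Finset (Fin M)) (c a : ℝ), a * M ≤ #S → 0 ≤ c →
      (∀ m ∈ S, c * 2 ^ n ≤ #(clash f m)) → a * c / 2 ≤ E := by
    intro S c a hS hc h
    refine le_trans ?_ hEc
    have h1 : (#S : ℝ) * (c * 2 ^ n) ≤ (∑ m, #(clash f m) : ℕ) := by
      push_cast
      rw [← nsmul_eq_mul]
      exact (Finset.card_nsmul_le_sum _ _ _ h).trans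
        (Finset.sum_le_sum_of_subset_of_nonneg (Finset.subset_univ _) fun _ _ _ => by positivity)
    have h2 : a * M * (c * 2 ^ n) ≤ (∑ m, #(clash f m) : ℕ) :=
      (mul_le_mul_of_nonneg_right hS (by positivity)).trans h1
    calc a * c / 2 = (1 / M) * (a * M * (c * 2 ^ n) / 2 ^ n / 2) := by field_simp
      _ ≤ _ := by gcongr
  set Bad : Finset (Fin M) :=
    {m | ∃ m', m' ≠ m ∧ Confusable (f m) (f m') ∧ hammingDist (f m) (f m') ≤ 2 * D} with hBad
  by_cases hB : (1 / 2 : ℝ) * M ≤ #Bad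
  · left
    have := key Bad (1 / 2 ^ (2 * D)) (1 / 2) hB (by positivity) (by
      intro m hm
      obtain ⟨m', h1, h2, h3⟩ := (Finset.mem_filter.1 hm).2
      rw [one_div_mul_eq_div]
      exact le_card_clash_of_close hq f h1 h2 h3)
    linarith
  · right
    push Not at hB
    set I : Finset (Fin M) := Badᶜ with hI
    have hIcard : (M : ℝ) / 2 ≤ #I := by
      have h1 : #Bad + #I = M := by rw [hI, Finset.card_add_card_compl, Fintype.card_fin]
      have h2 : (#Bad : ℝ) + #I = M := by exact_mod_cast h1
      linarith
    have hIfar : ∀ b ∈ I, ∀ c, c ≠ b → Confusable (f b) (f c) →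
        2 * D < hammingDist (f b) (f c) := by
      intro b hb c hc hbc
      by_contra h
      rw [hI, Finset.mem_compl] at hb
      exact hb (Finset.mem_filter.2 ⟨Finset.mem_univ _, c, hc, hbc, not_lt.1 h⟩)
    have hinj : Set.InjOn f I := by
      intro b hb c hc h
      by_contra hne
      have h1 : Confusable (f b) (f c) := by
        intro i; rw [h]; simp
      have h2 := hIfar b hb c (Ne.symm hne) h1
      rw [h, hammingDist_self] at h2
      omega
    set Low : Finset (Fin M) := {m ∈ I | ∀ d : ℕ, 1 ≤ d → (1 + β) * d < β * n - lam →
      4 * β * n * q ^ n * #(neighbours I f m d) < M / 4 * (n.choose d * 2 ^ d)} with hLow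
    have hLowI : Low ⊆ I := Finset.filter_subset _ _
    have hLowcard : (#Low : ℝ) < M / 4 := by
      by_contra h
      push Not at h
      have hpos : 0 < #Low := by
        have : (0 : ℝ) < #Low := by linarith
        exact_mod_cast this
      obtain ⟨a, ha, d, hd1, hd2, hd3⟩ := exists_many_neighbours hq hqo hβ hβc hn hγ0 hγt hγpos
        hlam hγ hx0 hx1 (hinj.mono hLowI) (Finset.card_pos.1 hpos)
        (hMx.trans (mul_le_mul_of_nonneg_right h (by positivity)))
      have h1 := (Finset.mem_filter.1 ha).2 d hd1 hd2
      have h2 : (#(neighbours Low f a d) : ℝ) ≤ #(neighbours I f a d) := by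
        have : neighbours Low f a d ⊆ neighbours I f a d :=
          Finset.filter_subset_filter _ hLowI
        exact_mod_cast Finset.card_le_card this
      have h3 : (M : ℝ) / 4 * (n.choose d * 2 ^ d) ≤ #Low * (n.choose d * 2 ^ d) := by gcongr
      have h4 : 4 * β * n * (q : ℝ) ^ n * #(neighbours Low f a d) ≤
        4 * β * n * q ^ n * #(neighbours I f a d) := by gcongr
      linarith
    set G : Finset (Fin M) := I \ Low with hG
    have hGcard : (1 / 4 : ℝ) * M ≤ #G := by
      have h1 : #G + #Low = #I := Finset.card_sdiff_add_card_eq_card hLowI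
      have h2 : (#G : ℝ) + #Low = #I := by exact_mod_cast h1
      linarith
    have hGne : G.Nonempty := by
      rw [← Finset.card_pos]
      have : (0 : ℝ) < #G := by linarith
      exact_mod_cast this
    obtain ⟨m, hm, hmin⟩ := Finset.exists_min_image G (fun m => #(clash f m)) hGne
    have hE' := key G (#(clash f m) / 2 ^ n) (1 / 4) hGcard (by positivity) (by
      intro m' hm'
      rw [div_mul_cancel₀ _ (by positivity)]
      exact_mod_cast hmin m' hm')
    rw [hG, Finset.mem_sdiff] at hm
    obtain ⟨hmI, hmL⟩ := hm
    have : ∃ d : ℕ, 1 ≤ d ∧ (1 + β) * d < β * n - lam ∧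
        M / 4 * (n.choose d * 2 ^ d) ≤ 4 * β * n * q ^ n * #(neighbours I f m d) := by
      by_contra h
      push Not at h
      exact hmL (Finset.mem_filter.2 ⟨hmI, h⟩)
    obtain ⟨d, hd1, hd2, hd3⟩ := this
    have hdn : d ≤ n := by
      have h1 : (d : ℝ) ≤ n := by
        have : (0 : ℝ) ≤ d := by positivity
        nlinarith
      exact_mod_cast h1
    have hC : (0 : ℝ) < n.choose d := by exact_mod_cast Nat.choose_pos hdn
    have hN : 0 < #(neighbours I f m d) := by
      have h1 : 0 < 4 * β * n * (q : ℝ) ^ n * #(neighbours I f m d) :=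
        lt_of_lt_of_le (by positivity) hd3
      have h2 : (0 : ℝ) < #(neighbours I f m d) := pos_of_mul_pos_right h1 (by positivity)
      exact_mod_cast h2
    obtain ⟨b, hb⟩ := Finset.card_pos.1 hN
    simp only [neighbours, Finset.mem_filter] at hb
    have hbm : b ≠ m := by
      rintro rfl
      have := hb.2.2
      rw [hammingDist_self] at this
      omega
    have hDd : 2 * D < d := hb.2.2 ▸ hIfar m hmI b hbm hb.2.1
    refine ⟨d, hDd, hd2, ?_⟩
    have hcl := le_card_clash_of_neighbours hq f hD hd1 hIfar (m := m)
    have hK : M * (n.choose d * 2 ^ d) / (16 * β * n * q ^ n) ≤ #(neighbours I f m d) := by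
      rw [div_le_iff₀ (by positivity)]
      linarith
    have hcl' : min (#(neighbours I f m d) : ℝ) (2 ^ (D - 1)) / 2 ^ d / 2 ≤
        #(clash f m) / 2 ^ n := by
      rw [le_div_iff₀ (by positivity)]
      calc _ = min (#(neighbours I f m d) : ℝ) (2 ^ (D - 1)) / 2 ^ d * 2 ^ n / 2 := by ring
        _ ≤ _ := hcl
    rcases min_cases (#(neighbours I f m d) : ℝ) (2 ^ (D - 1)) with h | h
    · left
      rw [h.1] at hcl'
      have h1 : M * (n.choose d * 2 ^ d) / (16 * β * n * q ^ n) / 2 ^ d ≤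
        (#(neighbours I f m d) : ℝ) / 2 ^ d := by gcongr
      linarith
    · right
      rw [h.1] at hcl'
      linarith

/-! ### A lower bound for binomial coefficients -/

theorem factorial_mul_pow_le (a k : ℕ) : a.factorial * a ^ k ≤ k.factorial * a ^ a := by
  rcases le_total a k with h | h
  · calc a.factorial * a ^ k = a.factorial * a ^ (k - a) * a ^ a := by
          rw [mul_assoc, ← pow_add, Nat.sub_add_cancel h]
      _ ≤ _ := Nat.mul_le_mul_right _ (Nat.factorial_mul_pow_sub_le_factorial h)
  · have h1 := Nat.factorial_mul_descFactorial (Nat.sub_le a k)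
    rw [Nat.sub_sub_self h] at h1
    calc a.factorial * a ^ k = k.factorial * a.descFactorial (a - k) * a ^ k := by rw [h1]
      _ ≤ k.factorial * a ^ (a - k) * a ^ k :=
        Nat.mul_le_mul_right _ (Nat.mul_le_mul_left _ (Nat.descFactorial_le_pow _ _))
      _ = _ := by rw [mul_assoc, ← pow_add, Nat.sub_add_cancel h]

theorem choose_mul_pow_le {n d k : ℕ} (hd : d ≤ n) (hk : k ≤ n) :
    n.choose k * (d ^ k * (n - d) ^ (n - k)) ≤ n.choose d * (d ^ d * (n - d) ^ (n - d)) := by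
  have h1 := Nat.mul_le_mul (factorial_mul_pow_le d k) (factorial_mul_pow_le (n - d) (n - k))
  have h2 := Nat.choose_mul_factorial_mul_factorial hd
  have h3 := Nat.choose_mul_factorial_mul_factorial hk
  have hpos : 0 < k.factorial * (n - k).factorial * (d.factorial * (n - d).factorial) := by
    positivity
  refine Nat.le_of_mul_le_mul_right ?_ hpos
  calc _ = (n.choose k * k.factorial * (n - k).factorial) *
        (d.factorial * d ^ k * ((n - d).factorial * (n - d) ^ (n - k))) := by ring
    _ ≤ (n.choose d * d.factorial * (n - d).factorial) *
        (k.factorial * d ^ d * ((n - k).factorial * (n - d) ^ (n - d))) := by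
      rw [h2, h3]; exact Nat.mul_le_mul_left _ h1
    _ = _ := by ring

theorem pow_le_choose_mul {n d : ℕ} (hd : d ≤ n) :
    n ^ n ≤ (n + 1) * (n.choose d * (d ^ d * (n - d) ^ (n - d))) := by
  have h := add_pow d (n - d) n
  rw [Nat.add_sub_cancel' hd] at h
  rw [h, ← smul_eq_mul (a := n + 1), ← Finset.card_range (n + 1), ← Finset.sum_const]
  simp only [Finset.card_range]
  refine Finset.sum_le_sum fun k hk => ?_
  rw [mul_comm]
  exact choose_mul_pow_le hd (Nat.lt_succ_iff.1 (Finset.mem_range.1 hk))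

theorem h3_le_log_choose {n d : ℕ} (hd0 : 0 < d) (hd : d < n) :
    n * h3 (d / n) ≤ Real.logb 2 (n + 1) + Real.logb 2 (n.choose d * 2 ^ d) := by
  have hd0r : (0 : ℝ) < d := by exact_mod_cast hd0
  have hdr : (d : ℝ) < n := by exact_mod_cast hd
  have hn0 : (0 : ℝ) < n := by linarith
  have hnd : (0 : ℝ) < n - d := by linarith
  have hC : (0 : ℝ) < n.choose d := by exact_mod_cast Nat.choose_pos hd.le
  have h1 : ((n : ℝ)) ^ n ≤ (n + 1) * (n.choose d * (d ^ d * ((n : ℝ) - d) ^ (n - d))) := by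
    have := pow_le_choose_mul hd.le
    have h2 : (((n - d : ℕ) : ℕ) : ℝ) = n - d := Nat.cast_sub hd.le
    rw [← h2]
    exact_mod_cast this
  have h2 := Real.logb_le_logb_of_le (by norm_num : (1 : ℝ) < 2) (by positivity) h1
  rw [Real.logb_mul (by positivity) (by positivity), Real.logb_mul (by positivity) (by positivity),
    Real.logb_mul (by positivity) (by positivity), Real.logb_pow, Real.logb_pow, Real.logb_pow,
    Nat.cast_sub hd.le] at h2
  rw [Real.logb_mul (by positivity) (by positivity), Real.logb_pow]
  have h3' : (1 : ℝ) - d / n = (n - d) / n := by field_simp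
  unfold h3
  rw [h3', Real.logb_div hd0r.ne' hn0.ne', Real.logb_div hnd.ne' hn0.ne', Real.logb_self_eq_one
    (by norm_num)]
  have h4 : n * (d / n * 1 - d / n * (Real.logb 2 d - Real.logb 2 n) -
      (n - d) / n * (Real.logb 2 (n - d) - Real.logb 2 n)) =
      d - d * (Real.logb 2 d - Real.logb 2 n) - (n - d) * (Real.logb 2 (n - d) - Real.logb 2 n) := by
    field_simp
  rw [h4]
  linarith

/-! ### Asymptotic choice of the parameters -/

/-- The map `δ ↦ ((q'-1) - (q'-2)δ - 2√((q'-1)δ(1-δ)))/q'`, with `q' = 1 + β`, is an involution of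
`(0, β / (1 + β))`. -/
theorem involution_spec {β s ρ : ℝ} (hβ : 1 ≤ β) (hs0 : 0 < s) (hs1 : s < β / (1 + β))
    (hρ : ρ = (β - (β - 1) * s - 2 * √(β * s * (1 - s))) / (1 + β)) :
    0 < ρ ∧ ρ < β / (1 + β) ∧
      β - ((β - 1) * ρ + 2 * √(β * ρ * (1 - ρ))) = (1 + β) * s := by
  have hβ0 : 0 < β := by linarith
  have hβ1 : 0 < 1 + β := by linarith
  rw [lt_div_iff₀ hβ1] at hs1 ⊢
  have hs2 : 0 < 1 - s := by nlinarith
  obtain ⟨a, ha0, rfl⟩ : ∃ a, 0 < a ∧ a ^ 2 = s := ⟨√s, Real.sqrt_pos.2 hs0, Real.sq_sqrt hs0.le⟩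
  obtain ⟨b, hb0, hb⟩ : ∃ b, 0 < b ∧ b ^ 2 = 1 - a ^ 2 :=
    ⟨√(1 - a ^ 2), Real.sqrt_pos.2 hs2, Real.sq_sqrt hs2.le⟩
  obtain ⟨c, hc0, rfl⟩ : ∃ c, 0 < c ∧ c ^ 2 = β := ⟨√β, Real.sqrt_pos.2 hβ0, Real.sq_sqrt hβ0.le⟩
  have hsq : √(c ^ 2 * a ^ 2 * (1 - a ^ 2)) = c * a * b := by
    rw [← hb, ← mul_pow, ← mul_pow, Real.sqrt_sq (by positivity)]
  rw [hsq] at hρ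
  have hcb : a < c * b := by
    refine lt_of_pow_lt_pow_left₀ 2 (by positivity) ?_
    rw [mul_pow, hb]
    linarith
  have hρ1 : ρ = (c * b - a) ^ 2 / (1 + c ^ 2) := by
    rw [hρ]; congr 1; linear_combination c ^ 2 * (-hb)
  have hρ2 : 1 - ρ = (b + c * a) ^ 2 / (1 + c ^ 2) := by
    rw [hρ1, eq_div_iff hβ1.ne', sub_mul, div_mul_cancel₀ _ hβ1.ne']
    linear_combination (-(1 + c ^ 2)) * hb
  have hsq2 : √(c ^ 2 * ρ * (1 - ρ)) = c * (c * b - a) * (b + c * a) / (1 + c ^ 2) := by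
    have h1 : c ^ 2 * ρ * (1 - ρ) = (c * (c * b - a) * (b + c * a) / (1 + c ^ 2)) ^ 2 := by
      rw [hρ2, hρ1]; ring
    have h2 : 0 < c * b - a := by linarith
    rw [h1, Real.sqrt_sq (by positivity)]
  refine ⟨?_, ?_, ?_⟩
  · rw [hρ1]
    have h2 : 0 < c * b - a := by linarith
    positivity
  · rw [hρ1, div_mul_cancel₀ _ hβ1.ne']
    have hb1 : b < 1 := by nlinarith
    have : c * b - a < c := by nlinarith
    exact pow_lt_pow_left₀ this (by linarith) (by norm_num)
  · rw [hsq2, hρ1]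
    field_simp
    linear_combination (-(c ^ 2 * (1 + c ^ 2))) * hb

theorem eventually_logb_mul_le {C c : ℝ} (hC : 0 < C) (hc : 0 < c) :
    ∀ᶠ n : ℕ in Filter.atTop, Real.logb 2 (C * n) ≤ c * n := by
  have h1 := (Real.isLittleO_log_id_atTop.bound
    (by positivity : 0 < c * Real.log 2 / 2)).natCast_atTop
  have h2 : Filter.Tendsto (fun n : ℕ => c * Real.log 2 / 2 * n) Filter.atTop Filter.atTop :=
    Filter.Tendsto.const_mul_atTop (by have := Real.log_pos one_lt_two; positivity)
      tendsto_natCast_atTop_atTop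
  filter_upwards [h1, h2.eventually_ge_atTop (Real.log C), Filter.eventually_gt_atTop 0]
    with n hn1 hn2 hn3
  have hn : (0 : ℝ) < n := by exact_mod_cast hn3
  have hl := Real.log_pos one_lt_two
  rw [Real.logb, div_le_iff₀ hl, Real.log_mul hC.ne' hn.ne']
  simp only [id, Real.norm_eq_abs, abs_of_pos hn] at hn1
  have := (le_abs_self _).trans hn1
  linarith

theorem exists_eigenvector_parameters {β ρ s η : ℝ} (hβ : 1 ≤ β) (hρ0 : 0 < ρ) (hρ1 : ρ < 1)
    (hs : β - ((β - 1) * ρ + 2 * √(β * ρ * (1 - ρ))) = (1 + β) * s) (hη : 0 < η) :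
    ∃ ξ : ℝ, 0 < ξ ∧ ∀ᶠ n : ℕ in Filter.atTop, ∃ (t : ℕ) (γ : ℕ → ℝ) (lam : ℝ),
      t ≤ (ρ - ξ) * n ∧ 0 ≤ lam ∧ (∀ k, 0 ≤ γ k) ∧ (∀ k, t < k → γ k = 0) ∧
      (∃ k ≤ n, 0 < γ k) ∧
      (∀ k ≤ n, (lam + 1) * γ k ≤
        k * γ (k - 1) + (β - 1) * k * γ k + β * (n - k) * γ (k + 1)) ∧
      ∀ d : ℝ, (1 + β) * d < β * n - lam → d < (s + η) * n := by
  have hβ0 : 0 < β := by linarith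
  set L : ℝ → ℝ := fun ξ =>
    (β - 1) * (ρ - 2 * ξ) + 2 * (1 - ξ) * √(β * (ρ - 2 * ξ) * (1 - ρ + ξ)) with hL
  have hLc : Continuous L := by rw [hL]; fun_prop
  have hL0 : L 0 > β - (1 + β) * (s + η / 2) := by
    have : L 0 = β - (1 + β) * s := by
      rw [← hs, hL]; simp
    rw [this]; nlinarith
  have hev : ∀ᶠ ξ in nhdsWithin (0 : ℝ) (Set.Ioi 0),
      L ξ > β - (1 + β) * (s + η / 2) ∧ ξ < ρ / 4 ∧ ξ < 1 / 2 := by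
    refine nhdsWithin_le_nhds ?_
    have e1 := hLc.continuousAt.eventually (lt_mem_nhds hL0)
    have e2 := eventually_lt_nhds (by positivity : (0 : ℝ) < ρ / 4)
    have e3 := eventually_lt_nhds (by norm_num : (0 : ℝ) < 1 / 2)
    filter_upwards [e1, e2, e3] with ξ h1 h2 h3 using ⟨h1, h2, h3⟩
  obtain ⟨ξ, ⟨hξL, hξρ, hξ1⟩, hξ0⟩ := (hev.and self_mem_nhdsWithin).exists
  replace hξ0 : 0 < ξ := hξ0
  have hcos : ∃ m : ℕ, 1 ≤ m ∧ 1 - ξ < Real.cos (Real.pi / (m + 1)) := by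
    have h1 : Filter.Tendsto (fun m : ℕ => Real.cos (Real.pi / ((m : ℝ) + 1))) Filter.atTop
        (nhds (Real.cos 0)) := by
      refine (Real.continuous_cos.tendsto 0).comp ?_
      have := (tendsto_one_div_add_atTop_nhds_zero_nat (𝕜 := ℝ)).const_mul Real.pi
      simpa [div_eq_mul_inv] using this
    rw [Real.cos_zero] at h1
    obtain ⟨m, hm1, hm2⟩ := ((h1.eventually (lt_mem_nhds (by linarith : 1 - ξ < 1))).and
      (Filter.eventually_ge_atTop 1)).exists
    exact ⟨m, hm2, hm1⟩
  obtain ⟨m, hm1, hm⟩ := hcos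
  have hρξ : 0 < ρ - 2 * ξ := by linarith
  have hLpos : 0 < L ξ := by
    have h1 : 0 < √(β * (ρ - 2 * ξ) * (1 - ρ + ξ)) :=
      Real.sqrt_pos.2 (mul_pos (mul_pos hβ0 hρξ) (by linarith))
    have h2 : 0 ≤ (β - 1) * (ρ - 2 * ξ) := mul_nonneg (by linarith) hρξ.le
    have h3 : 0 < 2 * (1 - ξ) * √(β * (ρ - 2 * ξ) * (1 - ρ + ξ)) :=
      mul_pos (by linarith) h1
    simp only [hL]
    linarith
  refine ⟨ξ, hξ0, ?_⟩
  have big : ∀ {c : ℝ} (C : ℝ), 0 < c → ∀ᶠ n : ℕ in Filter.atTop, C ≤ c * n := fun C hc =>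
    (tendsto_natCast_atTop_atTop.const_mul_atTop hc).eventually_ge_atTop C
  filter_upwards [big (m + 1) hξ0, big 1 hρξ, big 1 hLpos,
    big 1 (by positivity : 0 < (1 + β) * (η / 2)), Filter.eventually_gt_atTop 0]
    with n n1 n2 n3 n4 n5
  have hn : (0 : ℝ) < n := by exact_mod_cast n5
  set t : ℕ := ⌊(ρ - ξ) * n⌋₊ with ht
  have hξn : 0 ≤ (ρ - ξ) * n := mul_nonneg (by linarith) hn.le
  have ht1 : (t : ℝ) ≤ (ρ - ξ) * n := Nat.floor_le hξn
  have ht2 : (ρ - ξ) * n < t + 1 := Nat.lt_floor_add_one _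
  have hmt : m + 1 ≤ t := by
    have : ((m + 1 : ℕ) : ℝ) < t + 1 := by
      push_cast
      nlinarith
    have : m + 1 < t + 1 := by exact_mod_cast this
    have h2 : ((m : ℝ) + 1) < t := by nlinarith
    have : m + 1 < t := by exact_mod_cast h2
    omega
  obtain ⟨k₀, hk₀⟩ : ∃ k₀, t = k₀ + m := ⟨t - m, by omega⟩
  have hk₀1 : 1 ≤ k₀ := by omega
  have htr : (t : ℝ) = k₀ + m := by exact_mod_cast hk₀
  have hk₀r : (ρ - 2 * ξ) * n ≤ k₀ := by nlinarith
  have htn : k₀ + m < n := by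
    have : (t : ℝ) < n := by nlinarith
    rw [hk₀] at this
    exact_mod_cast this
  obtain ⟨γ, g1, g2, g3, g4⟩ := exists_radial_subeigenvector hβ hm1 hk₀1 htn
  have hΛ : L ξ * n ≤ (β - 1) * k₀ + 2 * Real.cos (Real.pi / (m + 1)) *
      √(β * k₀ * (n - (k₀ + m))) := by
    have h1 : (β - 1) * ((ρ - 2 * ξ) * n) ≤ (β - 1) * k₀ :=
      mul_le_mul_of_nonneg_left hk₀r (by linarith)
    have h2 : √(β * (ρ - 2 * ξ) * (1 - ρ + ξ)) * n ≤ √(β * k₀ * (n - (k₀ + m))) := by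
      apply Real.le_sqrt_of_sq_le
      have h1ρ : 0 ≤ 1 - ρ + ξ := by linarith
      rw [mul_pow, Real.sq_sqrt (by positivity)]
      have h3 : (1 - ρ + ξ) * n ≤ n - (k₀ + m) := by rw [← htr]; linarith
      calc β * (ρ - 2 * ξ) * (1 - ρ + ξ) * n ^ 2 =
            β * ((ρ - 2 * ξ) * n) * ((1 - ρ + ξ) * n) := by ring
        _ ≤ _ := by gcongr
    have h3 : 2 * (1 - ξ) * (√(β * (ρ - 2 * ξ) * (1 - ρ + ξ)) * n) ≤
        2 * Real.cos (Real.pi / (m + 1)) * √(β * k₀ * (n - (k₀ + m))) := by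
      have : 0 ≤ 2 * (1 - ξ) := by linarith
      gcongr
      linarith
    calc L ξ * n = (β - 1) * ((ρ - 2 * ξ) * n) +
          2 * (1 - ξ) * (√(β * (ρ - 2 * ξ) * (1 - ρ + ξ)) * n) := by simp only [hL]; ring
      _ ≤ _ := add_le_add h1 h3
  refine ⟨t, γ, (β - 1) * k₀ + 2 * Real.cos (Real.pi / (m + 1)) *
      √(β * k₀ * (n - (k₀ + m))) - 1, ht1, by linarith, g1, ?_, g3, ?_, ?_⟩
  · rw [hk₀]; exact g2
  · rw [sub_add_cancel]; exact g4
  · intro d hd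
    have h1 : (1 + β) * d < (1 + β) * ((s + η) * n) := by
      have := mul_lt_mul_of_pos_right hξL hn
      nlinarith
    exact lt_of_mul_lt_mul_left h1 (by linarith)

/-- The Chernoff weight of a Hamming ball of radius `(ρ - ξ) n` is negligible compared to the size
of a code of rate `log₂ (q / (1 + β)) + h_{1+β}(ρ)`. -/
theorem eventually_ball_small {β ρ R ξ q : ℝ} (hβ : 1 ≤ β) (hq : 0 < q) (hρ0 : 0 < ρ)
    (hρ1 : ρ < β / (1 + β)) (hξ : 0 < ξ)
    (hR : R = Real.logb 2 (q / (1 + β)) + hqary (1 + β) ρ) :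
    0 < ρ / (β * (1 - ρ)) ∧ ρ / (β * (1 - ρ)) ≤ 1 ∧
    ∀ᶠ n : ℕ in Filter.atTop, ∀ (t : ℕ) (M : ℝ), t ≤ (ρ - ξ) * n → 2 ^ (n * R) ≤ M →
      4 * β * n * ((ρ / (β * (1 - ρ)))⁻¹ ^ t * (1 + β * (ρ / (β * (1 - ρ)))) ^ n) * q ^ n ≤
        M / 4 * (1 + β) ^ n := by
  have hβ0 : 0 < β := by linarith
  have hβ1 : 0 < 1 + β := by linarith
  rw [lt_div_iff₀ hβ1] at hρ1
  have hρ2 : 0 < 1 - ρ := by nlinarith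
  set x := ρ / (β * (1 - ρ)) with hx
  have hx0 : 0 < x := by positivity
  have hx1 : x < 1 := by
    rw [hx, div_lt_one (by positivity)]; linarith
  refine ⟨hx0, hx1.le, ?_⟩
  have hlx : Real.logb 2 x < 0 := Real.logb_neg (by norm_num) hx0 hx1
  filter_upwards [eventually_logb_mul_le (by positivity : 0 < 16 * β)
    (mul_pos hξ (neg_pos.2 hlx)), Filter.eventually_gt_atTop 0] with n h1 hn0 t M ht hM
  have hn : (0 : ℝ) < n := by exact_mod_cast hn0
  have h1x : 1 + β * x = (1 - ρ)⁻¹ := by rw [hx]; field_simp; ring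
  refine le_trans ?_ (mul_le_mul_of_nonneg_right (div_le_div_of_nonneg_right hM (by norm_num))
    (by positivity))
  suffices h : 16 * β * n * (x⁻¹ ^ t * (1 + β * x) ^ n) * q ^ n ≤
      2 ^ ((n : ℝ) * R) * (1 + β) ^ n by linarith
  have hP : 0 < 16 * β * n := by positivity
  generalize 16 * β * (n : ℝ) = P at h1 hP ⊢
  rw [h1x, ← Real.logb_le_logb (b := 2) (by norm_num) (by positivity) (by positivity),
    Real.logb_mul (by positivity) (by positivity), Real.logb_mul (by positivity) (by positivity),
    Real.logb_mul (by positivity) (by positivity), Real.logb_mul (by positivity) (by positivity),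
    Real.logb_pow, Real.logb_pow, Real.logb_pow, Real.logb_pow,
    Real.logb_rpow (by norm_num) (by norm_num), Real.logb_inv, Real.logb_inv, hR,
    Real.logb_div hq.ne' hβ1.ne', hqary, add_sub_cancel_left]
  have hlx' : Real.logb 2 x = Real.logb 2 ρ - (Real.logb 2 β + Real.logb 2 (1 - ρ)) := by
    rw [hx, Real.logb_div hρ0.ne' (by positivity), Real.logb_mul hβ0.ne' hρ2.ne']
  have h2 : (t : ℝ) * -Real.logb 2 x ≤ (ρ - ξ) * n * -Real.logb 2 x :=
    mul_le_mul_of_nonneg_right ht (by linarith)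
  have h3 : (n : ℝ) * (ρ * -Real.logb 2 x) =
      n * (ρ * (Real.logb 2 β + Real.logb 2 (1 - ρ) - Real.logb 2 ρ)) := by rw [hlx']; ring
  linarith

theorem continuous_h3 : Continuous h3 := by
  have h1 : h3 = fun x => (x * Real.log 2 - x * Real.log x - (1 - x) * Real.log (1 - x)) /
      Real.log 2 := by
    funext x
    simp only [h3, Real.logb]
    ring
  rw [h1]
  have h2 : Continuous fun x : ℝ => (1 - x) * Real.log (1 - x) :=
    Real.continuous_mul_log.comp (by fun_prop : Continuous fun x : ℝ => 1 - x)
  exact (((continuous_id.mul continuous_const).sub Real.continuous_mul_log).sub h2).div_const _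

theorem exists_h3_close {s ε : ℝ} (hε : 0 < ε) :
    ∃ η, 0 < η ∧ ∀ τ, s ≤ τ → τ < s + η → h3 s - ε < h3 τ := by
  obtain ⟨η, hη, h⟩ := Metric.continuous_iff.1 continuous_h3 s ε hε
  refine ⟨η, hη, fun τ h1 h2 => ?_⟩
  have := h τ (by rw [Real.dist_eq, abs_lt]; constructor <;> linarith)
  rw [Real.dist_eq, abs_lt] at this
  linarith

/-- The exponent bound at an admissible distance `τ` slightly beyond the interval. -/
theorem exponent_dichotomy {B R δ₀ s η η' δ τ lq : ℝ}
    (hB : ∀ δ τ : ℝ, δ₀ ≤ δ → δ ≤ s → δ ≤ τ → τ ≤ s →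
      min δ (τ - min (R - (lq - h3 τ)) (δ / 2)) ≤ B)
    (hB0 : δ₀ ≤ B) (hη : 0 < η) (hη' : η' ≤ η / 8)
    (hh3 : ∀ τ, s ≤ τ → τ < s + η' → h3 s - η / 8 < h3 τ)
    (hδ : δ = B + η / 2) (hδτ : δ < τ) (hτ : τ < s + η') :
    τ - B - η / 4 ≤ R - (lq - h3 τ) ∧ τ - B - η / 4 ≤ δ / 2 := by
  have hτ' : min τ s ≤ s := min_le_right _ _
  have hδ1 : B + η / 4 ≤ min τ s := le_min (by linarith) (by linarith)
  have h := hB (B + η / 4) (min τ s) (by linarith) (hδ1.trans hτ') hδ1 hτ'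
  have h1 : min τ s - min (R - (lq - h3 (min τ s))) ((B + η / 4) / 2) ≤ B := by
    rcases min_le_iff.1 h with h | h
    · linarith
    · exact h
  have h2 := min_le_left (R - (lq - h3 (min τ s))) ((B + η / 4) / 2)
  have h3' := min_le_right (R - (lq - h3 (min τ s))) ((B + η / 4) / 2)
  rcases le_total τ s with hts | hts
  · rw [min_eq_left hts] at h1 h2 h3'
    constructor <;> linarith
  · rw [min_eq_right hts] at h1 h2 h3'
    have := hh3 τ hts hτ
    constructor <;> linarith

theorem logb_count {M C β n q : ℝ} (hM : 0 < M) (hC : 0 < C) (hβ : 0 < β) (hn : 0 < n) (hq : 0 < q)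
    (k d : ℕ) : Real.logb 2 (M * C / (16 * β * n * q ^ k) / 2 ^ d / 16) =
      Real.logb 2 M + Real.logb 2 C - Real.logb 2 (256 * β * n) - k * Real.logb 2 q - d := by
  have e2 : M * C / (16 * β * n * q ^ k) / 2 ^ d / 16 =
      M * C / (256 * β * n * (q ^ k * 2 ^ d)) := by
    field_simp; norm_num
  have hP : 0 < 256 * β * n := by positivity
  rw [e2]
  generalize 256 * β * n = P at hP ⊢
  rw [Real.logb_div (by positivity) (by positivity), Real.logb_mul hM.ne' hC.ne',
    Real.logb_mul hP.ne' (by positivity), Real.logb_mul (by positivity) (by positivity),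
    Real.logb_pow, Real.logb_pow, Real.logb_self_eq_one (by norm_num)]
  ring

theorem eventually_error_lower_bound {q : ℕ} [NeZero q] (hq : 3 ≤ q) (hqo : Odd q)
    {β R δ₀ s B η : ℝ} (hβ : 1 ≤ β) (hβc : β * Real.cos (Real.pi / q) ≤ 1)
    (hδ₀ : 0 ≤ δ₀) (hs0 : 0 < s) (hs1 : s < β / (1 + β))
    (hR : R = Real.logb 2 (q / (1 + β)) + RLP1 (1 + β) s)
    (hB : ∀ δ τ : ℝ, δ₀ ≤ δ → δ ≤ s → δ ≤ τ → τ ≤ s →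
      min δ (τ - min (R - (Real.logb 2 q - h3 τ)) (δ / 2)) ≤ B)
    (hB0 : δ₀ ≤ B) (hη : 0 < η) :
    ∀ᶠ n : ℕ in Filter.atTop, ∀ M : ℕ, (2 : ℝ) ^ ((n : ℝ) * R) ≤ M →
      ∀ (f : Fin M → Fin n → ZMod q) (φ : (Fin n → ZMod q) → Fin M),
      (2 : ℝ) ^ (-(n * (B + η))) ≤ (1 / M) *
        ∑ m : Fin M, ∑ y : Fin n → ZMod q, if φ y = m then 0 else Wn q n (1 / 2) y (f m) := by
  have hβ0 : 0 < β := by linarith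
  have hqr : (0 : ℝ) < q := by exact_mod_cast (by omega : 0 < q)
  obtain ⟨η₁, hη₁, hh3⟩ := exists_h3_close (s := s) (by positivity : 0 < η / 8)
  set η' : ℝ := min η₁ (η / 8) with hη'
  have hη'0 : 0 < η' := lt_min hη₁ (by positivity)
  obtain ⟨ρ, hρ⟩ : ∃ ρ, ρ = (β - (β - 1) * s - 2 * √(β * s * (1 - s))) / (1 + β) := ⟨_, rfl⟩
  obtain ⟨hρ0, hρ1, hρs⟩ := involution_spec hβ hs0 hs1 hρ
  have hρ2 : ρ < 1 := hρ1.trans ((div_lt_one (by linarith)).2 (by linarith))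
  obtain ⟨ξ, hξ, hpar⟩ := exists_eigenvector_parameters hβ hρ0 hρ2 hρs hη'0
  have hR' : R = Real.logb 2 (q / (1 + β)) + hqary (1 + β) ρ := by
    rw [hR, RLP1, hρ]
    ring_nf
  obtain ⟨hx0, hx1, hball⟩ := eventually_ball_small hβ hqr hρ0 hρ1 hξ hR'
  set δ : ℝ := B + η / 2 with hδ
  have hδ0 : 0 < δ := by linarith
  have big : ∀ {c : ℝ} (C : ℝ), 0 < c → ∀ᶠ n : ℕ in Filter.atTop, C ≤ c * n := fun C hc =>
    (tendsto_natCast_atTop_atTop.const_mul_atTop hc).eventually_ge_atTop C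
  filter_upwards [hpar, hball, big 16 hη, Filter.eventually_gt_atTop 0,
    eventually_logb_mul_le (by positivity : 0 < 256 * β) (by positivity : 0 < η / 8),
    eventually_logb_mul_le (by norm_num : (0 : ℝ) < 2) (by positivity : 0 < η / 8)]
    with n hpar hball hbig hn0 hlog1 hlog2 M hMle f φ
  have hn : (0 : ℝ) < n := by exact_mod_cast hn0
  obtain ⟨t, γ, lam, ht, hlam, hγ0, hγt, hγpos, hγ, hlamd⟩ := hpar
  have hM0 : (0 : ℝ) < M := lt_of_lt_of_le (by positivity) hMle
  have hMlog : n * R ≤ Real.logb 2 M := by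
    rw [Real.le_logb_iff_rpow_le (by norm_num) hM0]
    exact hMle
  set D : ℕ := ⌈n * δ / 2⌉₊ with hD
  have hD1 : 1 ≤ D := Nat.ceil_pos.2 (by positivity)
  have hD2 : n * δ / 2 ≤ D := Nat.le_ceil _
  have hD3 : (D : ℝ) < n * δ / 2 + 1 := Nat.ceil_lt_add_one (by positivity)
  obtain ⟨E, hE⟩ : ∃ E, E = (1 / M) * ∑ m : Fin M, ∑ y : Fin n → ZMod q,
      if φ y = m then 0 else Wn q n (1 / 2) y (f m) := ⟨_, rfl⟩
  rw [← hE]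
  have hlb : ∀ v : ℝ, 0 < v → v ≤ E → -(n * (B + η)) ≤ Real.logb 2 v →
      (2 : ℝ) ^ (-(n * (B + η))) ≤ E := by
    intro v hv hvE h
    rw [Real.le_logb_iff_rpow_le (by norm_num) hv] at h
    exact h.trans hvE
  have hl4 : Real.logb 2 4 = 2 := by
    rw [show (4 : ℝ) = 2 ^ (2 : ℕ) by norm_num, Real.logb_pow, Real.logb_self_eq_one (by norm_num)]
    norm_num
  have hl16 : Real.logb 2 16 = 4 := by
    rw [show (16 : ℝ) = 2 ^ (4 : ℕ) by norm_num, Real.logb_pow,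
      Real.logb_self_eq_one (by norm_num)]
    norm_num
  have hl2 : ∀ k : ℕ, Real.logb 2 ((2 : ℝ) ^ k) = k := by
    intro k
    rw [Real.logb_pow, Real.logb_self_eq_one (by norm_num), mul_one]
  rcases error_lower_bound hq hqo hβ hβc hn0 hγ0 hγt hγpos hlam hγ hx0 hx1
    (by exact_mod_cast hM0) (hball t M ht hMle) hD1 f φ hE with h | ⟨d, hDd, hd, h⟩
  · refine hlb _ (by positivity) h ?_
    rw [Real.logb_div (by positivity) (by norm_num), one_div, Real.logb_inv, hl2, hl4]
    push_cast
    rw [hδ] at hD3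
    linarith
  · have hDd' : 2 * (D : ℝ) < d := by exact_mod_cast hDd
    have hds := hlamd d hd
    have hd0 : 0 < d := by omega
    have hd0r : (0 : ℝ) < d := by exact_mod_cast hd0
    have hdn : d < n := by
      have : (d : ℝ) < n := by nlinarith
      exact_mod_cast this
    have hC : (0 : ℝ) < n.choose d := by exact_mod_cast Nat.choose_pos hdn.le
    have hδτ : δ < d / n := by rw [lt_div_iff₀ hn]; linarith
    have hτ : (d : ℝ) / n < s + η' := by rw [div_lt_iff₀ hn]; exact hds
    obtain ⟨k1, k2⟩ := exponent_dichotomy hB hB0 hη (min_le_right _ _)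
      (fun τ h1 h2 => hh3 τ h1 (h2.trans_le (by gcongr; exact min_le_left _ _))) hδ hδτ hτ
    have k1' := mul_le_mul_of_nonneg_left k1 hn.le
    have k2' := mul_le_mul_of_nonneg_left k2 hn.le
    have hdn' : (n : ℝ) * (d / n) = d := by field_simp
    have e1 : (n : ℝ) * (d / n - B - η / 4) = d - n * B - n * η / 4 := by
      rw [mul_sub, mul_sub, hdn']; ring
    rw [e1] at k1' k2'
    rcases h with h | h
    · refine hlb _ (by positivity) h ?_
      have hch := h3_le_log_choose hd0 hdn
      have hn1 : Real.logb 2 ((n : ℝ) + 1) ≤ Real.logb 2 (2 * n) := by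
        apply Real.logb_le_logb_of_le (by norm_num) (by positivity)
        have : (1 : ℝ) ≤ n := by exact_mod_cast hn0
        linarith
      rw [logb_count hM0 (by positivity) hβ0 hn hqr]
      have e3 : (n : ℝ) * (R - (Real.logb 2 q - h3 (d / n))) =
          n * R - n * Real.logb 2 q + n * h3 (d / n) := by ring
      rw [e3] at k1'
      linarith
    · refine hlb _ (by positivity) h ?_
      rw [Real.logb_div (by positivity) (by norm_num), Real.logb_div (by positivity)
        (by positivity), hl2, hl2, hl16, Nat.cast_sub hD1]
      push_cast
      linarith

theorem le_Pe {q n M : ℕ} [NeZero q] {ε v : ℝ} (hM : 0 < M)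
    (h : ∀ (f : Fin M → Fin n → ZMod q) (φ : (Fin n → ZMod q) → Fin M),
      v ≤ (1 / M) * ∑ m : Fin M, ∑ y : Fin n → ZMod q,
        if φ y = m then 0 else Wn q n ε y (f m)) : v ≤ Pe q ε M n := by
  refine le_csInf ⟨_, fun _ _ => 0, fun _ => ⟨0, hM⟩, rfl⟩ ?_
  rintro p ⟨f, φ, rfl⟩
  exact h f φ

theorem limsup_le_of_forall_pos {u : ℕ → ℝ} {B : ℝ} (hB : 0 ≤ B)
    (h : ∀ η : ℝ, 0 < η → ∀ᶠ n in Filter.atTop, u n ≤ B + η) :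
    Filter.limsup u Filter.atTop ≤ B := by
  refine le_of_forall_pos_le_add fun η hη => ?_
  rw [Filter.limsup_eq]
  by_cases hb : BddBelow {a | ∀ᶠ n in Filter.atTop, u n ≤ a}
  · exact csInf_le hb (h η hη)
  · rw [Real.sInf_of_not_bddBelow hb]
    positivity

theorem EReliability_le {q : ℕ} [NeZero q] {ε R B : ℝ} (hB : 0 ≤ B)
    (h : ∀ η : ℝ, 0 < η → ∀ᶠ n : ℕ in Filter.atTop, ∀ M : ℕ, (2 : ℝ) ^ ((n : ℝ) * R) ≤ M →
      ∀ (f : Fin M → Fin n → ZMod q) (φ : (Fin n → ZMod q) → Fin M),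
      (2 : ℝ) ^ (-(n * (B + η))) ≤ (1 / M) *
        ∑ m : Fin M, ∑ y : Fin n → ZMod q, if φ y = m then 0 else Wn q n ε y (f m)) :
    EReliability q ε R ≤ B := by
  refine limsup_le_of_forall_pos hB fun η hη => ?_
  filter_upwards [h η hη, Filter.eventually_gt_atTop 0] with n hn hn0
  have hn0r : (0 : ℝ) < n := by exact_mod_cast hn0
  have hv : (0 : ℝ) < 2 ^ (-(n * (B + η))) := by positivity
  have hPe := le_Pe (Nat.ceil_pos.2 (by positivity)) (hn _ (Nat.le_ceil _))
  rw [one_div_mul_eq_div, div_le_iff₀ hn0r, one_div, Real.logb_inv]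
  have h1 := (Real.le_logb_iff_rpow_le (by norm_num) (hv.trans_le hPe)).2 hPe
  linarith

end Typewriter

/- Statement 10: Kalai–Linial-type upper bound for odd `q` and `ε = 1/2`.
Here `θ_q = q cos(π/q)/(1+cos(π/q))`, `q' = 1 + 1/cos(π/q)`, `δ₀ ∈ [0,2/3]` solves
`h₃(δ₀) = log₂ q - R`, and `s ∈ (0,(q'-1)/q')` solves `R = log₂ θ_q + R_LP1(q',s)`. -/
theorem stmt10 (q : ℕ) [NeZero q] (hq : 5 ≤ q) (hqo : Odd q)
    (R δ₀ s : ℝ)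
    (hR1 : Real.logb 2 ((q : ℝ) * Real.cos (Real.pi / q) / (1 + Real.cos (Real.pi / q))) < R)
    (hR2 : R < Real.logb 2 (q : ℝ))
    (hR3 : Real.logb 2 ((q : ℝ) / 3) ≤ R)
    (hδ₀0 : 0 ≤ δ₀) (hδ₀1 : δ₀ ≤ 2 / 3)
    (hδ₀eq : h3 δ₀ = Real.logb 2 (q : ℝ) - R)
    (hs0 : 0 < s)
    (hs1 : s < ((1 + 1 / Real.cos (Real.pi / q)) - 1) / (1 + 1 / Real.cos (Real.pi / q)))
    (hseq : R = Real.logb 2 ((q : ℝ) * Real.cos (Real.pi / q) / (1 + Real.cos (Real.pi / q)))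
              + RLP1 (1 + 1 / Real.cos (Real.pi / q)) s)
    (hδ₀s : δ₀ ≤ s) :
    EReliability q (1 / 2) R ≤
      sSup {v : ℝ | ∃ δ τ : ℝ, δ₀ ≤ δ ∧ δ ≤ s ∧ δ ≤ τ ∧ τ ≤ s ∧
        v = min δ (τ - min (R - (Real.logb 2 (q : ℝ) - h3 τ)) (δ / 2))} := by
  have hqr : (5 : ℝ) ≤ q := by exact_mod_cast hq
  have hcos : 0 < Real.cos (Real.pi / q) := by
    have h1 : Real.pi / q < Real.pi / 2 :=
      div_lt_div_of_pos_left Real.pi_pos (by norm_num) (by linarith)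
    have h2 : 0 < Real.pi / q := div_pos Real.pi_pos (by linarith)
    exact Real.cos_pos_of_mem_Ioo ⟨by linarith, h1⟩
  have hβ : 1 ≤ 1 / Real.cos (Real.pi / q) := by
    rw [le_div_iff₀ hcos, one_mul]
    exact Real.cos_le_one _
  have hβc : 1 / Real.cos (Real.pi / q) * Real.cos (Real.pi / q) ≤ 1 :=
    (div_mul_cancel₀ _ hcos.ne').le
  have hθ : (q : ℝ) * Real.cos (Real.pi / q) / (1 + Real.cos (Real.pi / q)) =
      q / (1 + 1 / Real.cos (Real.pi / q)) := by
    field_simp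
    ring
  rw [hθ] at hseq
  rw [add_sub_cancel_left] at hs1
  set S : Set ℝ := {v : ℝ | ∃ δ τ : ℝ, δ₀ ≤ δ ∧ δ ≤ s ∧ δ ≤ τ ∧ τ ≤ s ∧
    v = min δ (τ - min (R - (Real.logb 2 (q : ℝ) - h3 τ)) (δ / 2))} with hS
  have hbdd : BddAbove S := by
    refine ⟨s, ?_⟩
    rintro v ⟨δ, τ, -, h, -, -, rfl⟩
    exact (min_le_left _ _).trans h
  have hB : ∀ δ τ : ℝ, δ₀ ≤ δ → δ ≤ s → δ ≤ τ → τ ≤ s →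
      min δ (τ - min (R - (Real.logb 2 (q : ℝ) - h3 τ)) (δ / 2)) ≤ sSup S :=
    fun δ τ h1 h2 h3 h4 => le_csSup hbdd ⟨δ, τ, h1, h2, h3, h4, rfl⟩
  have hB0 : δ₀ ≤ sSup S := by
    have h := hB δ₀ δ₀ le_rfl hδ₀s le_rfl hδ₀s
    rwa [hδ₀eq, sub_sub_cancel, sub_self, min_eq_left (by linarith : (0 : ℝ) ≤ δ₀ / 2), sub_zero,
      min_self] at h
  exact Typewriter.EReliability_le (hδ₀0.trans hB0) fun η hη =>
    Typewriter.eventually_error_lower_bound (by omega) hqo hβ hβc hδ₀0 hs0 hs1 hseq hB hB0 hη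
end

section
/- Let q ≥ 3 be an integer and a ≥ 0 a real number, and let A be the q × q real matrix indexed by ZMod q with A(i,j) = 1 if i = j, A(i,j) = a if i − j = ±1, and A(i,j) = 0 otherwise. Then the eigenvalues of A are exactly the numbers 1 + 2a cos(2πk/q) for k = 0, 1, …, q−1, and consequently A is positive semidefinite if and only if 1 + 2a cos(2πk/q) ≥ 0 for all k; equivalently, A is positive semidefinite if and only if a ≤ 1/2 when q is even, and if and only if a ≤ 1/(2 cos(π/q)) when q is odd. -/
open Matrix

/-- The symmetric circulant matrix of the cycle: `1` on the diagonal, `a` at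
`i - j = ±1`, `0` elsewhere. -/
noncomputable def cycMatrix (q : ℕ) (a : ℝ) : Matrix (ZMod q) (ZMod q) ℝ :=
  fun i j => if i = j then 1 else if i - j = 1 ∨ i - j = -1 then a else 0

theorem cycMatrix_mulVec (q : ℕ) [NeZero q] (hq : 3 ≤ q) (a : ℝ) (v : ZMod q → ℝ) (i : ZMod q) :
    (cycMatrix q a).mulVec v i = v i + a * (v (i - 1) + v (i + 1)) := by
  have h1 : (1 : ZMod q) ≠ 0 := fun h => by
    have h' : ((1 : ℕ) : ZMod q) = 0 := by exact_mod_cast h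
    rw [ZMod.natCast_eq_zero_iff] at h'
    have := Nat.le_of_dvd one_pos h'
    omega
  have h2 : (1 : ZMod q) ≠ -1 := fun h => by
    have h' : ((2 : ℕ) : ZMod q) = 0 := by push_cast; linear_combination h
    rw [ZMod.natCast_eq_zero_iff] at h'
    have := Nat.le_of_dvd two_pos h'
    omega
  have key : ∀ j, cycMatrix q a i j * v j =
      (if j = i then v j else 0) + ((if j = i - 1 then a * v j else 0) +
        (if j = i + 1 then a * v j else 0)) := by
    intro j
    have e1 : i - j = 1 ↔ j = i - 1 :=
      ⟨fun h => by linear_combination -h, fun h => by linear_combination -h⟩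
    have e2 : i - j = -1 ↔ j = i + 1 :=
      ⟨fun h => by linear_combination -h, fun h => by linear_combination -h⟩
    unfold cycMatrix
    simp only [e1, e2, eq_comm (a := i) (b := j)]
    by_cases c0 : j = i
    · subst c0
      have : j ≠ j - 1 := fun h => h1 (by linear_combination h)
      simp [h1, this]
    · by_cases c1 : j = i - 1
      · subst c1
        have : i - 1 ≠ i + 1 := fun h => h2 (by linear_combination -h)
        simp [h1, this]
      · by_cases c2 : j = i + 1
        · subst c2
          simp [h1, c1]
        · simp [c0, c1, c2]
  simp only [mulVec, dotProduct, key, Finset.sum_add_distrib, Finset.sum_ite_eq', Finset.mem_univ,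
    if_true]
  ring

theorem ZMod.stdAddChar_add_stdAddChar_neg (q : ℕ) [NeZero q] (n : ℕ) :
    ZMod.stdAddChar (n : ZMod q) + ZMod.stdAddChar (-(n : ZMod q)) =
      ((2 * Real.cos (2 * Real.pi * n / q) : ℝ) : ℂ) := by
  have h1 := ZMod.stdAddChar_coe (N := q) (n : ℤ)
  have h2 := ZMod.stdAddChar_coe (N := q) (-(n : ℤ))
  push_cast at h1 h2
  rw [h1, h2]
  push_cast
  rw [Complex.two_cos]
  congr 2 <;> ring

theorem exists_cycMatrix_eigenvector (q : ℕ) [NeZero q] (hq : 3 ≤ q) (a : ℝ) (n : ℕ) :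
    ∃ v : ZMod q → ℝ, v ≠ 0 ∧ (cycMatrix q a).mulVec v =
      (1 + 2 * a * Real.cos (2 * Real.pi * n / q)) • v := by
  refine ⟨fun j => (ZMod.stdAddChar ((n : ZMod q) * j)).re, fun h => ?_, ?_⟩
  · simpa using congrFun h 0
  · ext i
    rw [cycMatrix_mulVec q hq]
    have e1 : (n : ZMod q) * (i - 1) = n * i + -n := by ring
    have e2 : (n : ZMod q) * (i + 1) = n * i + n := by ring
    have h := ZMod.stdAddChar_add_stdAddChar_neg q n
    have h' : ZMod.stdAddChar ((n : ZMod q) * (i - 1)) + ZMod.stdAddChar ((n : ZMod q) * (i + 1)) =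
        ((2 * Real.cos (2 * Real.pi * n / q) : ℝ) : ℂ) * ZMod.stdAddChar ((n : ZMod q) * i) := by
      rw [e1, e2, AddChar.map_add_eq_mul, AddChar.map_add_eq_mul, ← h]
      ring
    have h'' := congrArg Complex.re h'
    rw [Complex.add_re, Complex.re_ofReal_mul] at h''
    simp only [Pi.smul_apply, smul_eq_mul, h'']
    ring

theorem cycMatrix_eigenvalue_eq (q : ℕ) [NeZero q] (hq : 3 ≤ q) (a μ : ℝ) (v : ZMod q → ℝ)
    (hv : v ≠ 0) (h : (cycMatrix q a).mulVec v = μ • v) :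
    ∃ k : Fin q, μ = 1 + 2 * a * Real.cos (2 * Real.pi * k / q) := by
  let f : ZMod q → ℂ := fun j => (v j : ℂ)
  have hf : f ≠ 0 := fun h0 => hv (funext fun j => by simpa [f] using congrFun h0 j)
  have hF : ZMod.dft f ≠ 0 := fun h0 => hf (by simpa using h0)
  obtain ⟨k, hk⟩ := Function.ne_iff.mp hF
  refine ⟨⟨k.val, ZMod.val_lt k⟩, ?_⟩
  have hc := ZMod.stdAddChar_add_stdAddChar_neg q k.val
  rw [ZMod.natCast_zmod_val] at hc
  have s1 : ∑ j, ZMod.stdAddChar (-(j * k)) * f (j - 1) = ZMod.stdAddChar (-k) * ZMod.dft f k := by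
    rw [ZMod.dft_apply, Finset.mul_sum]
    refine Fintype.sum_equiv (Equiv.subRight 1) _ _ fun j => ?_
    rw [smul_eq_mul, ← mul_assoc, ← AddChar.map_add_eq_mul, Equiv.subRight_apply]
    congr 2
    ring
  have s2 : ∑ j, ZMod.stdAddChar (-(j * k)) * f (j + 1) = ZMod.stdAddChar k * ZMod.dft f k := by
    rw [ZMod.dft_apply, Finset.mul_sum]
    refine Fintype.sum_equiv (Equiv.addRight 1) _ _ fun j => ?_
    rw [smul_eq_mul, ← mul_assoc, ← AddChar.map_add_eq_mul, Equiv.coe_addRight]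
    congr 2
    ring
  have hpt : ∀ j, (μ : ℂ) * f j = f j + a * (f (j - 1) + f (j + 1)) := fun j => by
    have := congrFun h j
    rw [cycMatrix_mulVec q hq, Pi.smul_apply, smul_eq_mul] at this
    simp only [f]
    exact_mod_cast this.symm
  have hsum : (μ : ℂ) * ZMod.dft f k = ZMod.dft f k +
      a * (ZMod.stdAddChar (-k) * ZMod.dft f k + ZMod.stdAddChar k * ZMod.dft f k) := by
    rw [← s1, ← s2, ZMod.dft_apply, ← Finset.sum_add_distrib, Finset.mul_sum, Finset.mul_sum,
      ← Finset.sum_add_distrib]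
    refine Finset.sum_congr rfl fun j _ => ?_
    rw [smul_eq_mul]
    linear_combination ZMod.stdAddChar (-(j * k)) * hpt j
  have : (μ : ℂ) = ((1 + 2 * a * Real.cos (2 * Real.pi * k.val / q) : ℝ) : ℂ) := by
    apply mul_right_cancel₀ hk
    rw [hsum]
    push_cast at hc ⊢
    linear_combination a * ZMod.dft f k * hc
  exact_mod_cast this

theorem cycMatrix_isHermitian (q : ℕ) (a : ℝ) : (cycMatrix q a).IsHermitian := by
  ext i j
  have e1 : j - i = 1 ↔ i - j = -1 :=
    ⟨fun h => by linear_combination -h, fun h => by linear_combination -h⟩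
  have e2 : j - i = -1 ↔ i - j = 1 :=
    ⟨fun h => by linear_combination -h, fun h => by linear_combination -h⟩
  simp only [conjTranspose_apply, cycMatrix, e1, e2, eq_comm (a := j) (b := i), star_trivial,
    or_comm]

theorem Matrix.IsHermitian.dotProduct_mulVec_nonneg_iff {n : Type*} [Fintype n] [DecidableEq n]
    {A : Matrix n n ℝ} (hA : A.IsHermitian) :
    (∀ v : n → ℝ, 0 ≤ v ⬝ᵥ A.mulVec v) ↔
      ∀ μ : ℝ, (∃ v : n → ℝ, v ≠ 0 ∧ A.mulVec v = μ • v) → 0 ≤ μ := by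
  constructor
  · rintro h μ ⟨v, hv, hμ⟩
    have hn := h v
    rw [hμ, dotProduct_smul, smul_eq_mul] at hn
    have hpos : 0 < v ⬝ᵥ v := by simpa using dotProduct_star_self_pos_iff.mpr hv
    exact nonneg_of_mul_nonneg_left hn hpos
  · intro h v
    have hps : A.PosSemidef := hA.posSemidef_iff_eigenvalues_nonneg.mpr fun i =>
      h _ ⟨_, fun h0 => hA.eigenvectorBasis.toBasis.ne_zero i (by ext j; simpa using congrFun h0 j),
        hA.mulVec_eigenvectorBasis i⟩
    simpa using hps.dotProduct_mulVec_nonneg v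

theorem Real.neg_cos_pi_div_le_cos_of_odd {q : ℕ} (hq : Odd q) {k : ℕ} (hk : k ≤ q) :
    -Real.cos (Real.pi / q) ≤ Real.cos (2 * Real.pi * k / q) := by
  have hq0 : (0 : ℝ) < q := by exact_mod_cast hq.pos
  have hk' : (k : ℝ) ≤ q := by exact_mod_cast hk
  have e : 2 * Real.pi * k / q = Real.pi * |2 * (k : ℝ) - q| / q + Real.pi ∨
      2 * Real.pi * k / q = Real.pi - Real.pi * |2 * (k : ℝ) - q| / q := by
    rcases abs_cases ((2 : ℝ) * k - q) with ⟨h, _⟩ | ⟨h, _⟩ <;> rw [h]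
    · left; field_simp; ring
    · right; field_simp; ring
  have hcos : Real.cos (2 * Real.pi * k / q) = -Real.cos (Real.pi * |2 * (k : ℝ) - q| / q) := by
    rcases e with e | e <;> rw [e]
    · exact Real.cos_add_pi _
    · exact Real.cos_pi_sub _
  rw [hcos, neg_le_neg_iff]
  have hle : (1 : ℝ) ≤ |2 * (k : ℝ) - q| := by
    have hz : (1 : ℤ) ≤ |2 * (k : ℤ) - q| := by
      obtain ⟨m, rfl⟩ := hq
      apply Int.one_le_abs
      omega
    exact_mod_cast hz
  apply Real.cos_le_cos_of_nonneg_of_le_pi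
  · positivity
  · rw [div_le_iff₀ hq0]
    gcongr
    rw [abs_le]
    constructor <;> linarith [Nat.cast_nonneg (α := ℝ) k]
  · gcongr
    exact le_mul_of_one_le_right Real.pi_pos.le hle

theorem forall_one_add_two_mul_cos_nonneg_iff {q : ℕ} (hq : 3 ≤ q) {a : ℝ} (ha : 0 ≤ a) :
    (∀ k : Fin q, 0 ≤ 1 + 2 * a * Real.cos (2 * Real.pi * k / q)) ↔
      ((Even q → a ≤ 1 / 2) ∧ (Odd q → a ≤ 1 / (2 * Real.cos (Real.pi / q)))) := by
  have hq3 : (3 : ℝ) ≤ q := by exact_mod_cast hq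
  have hq0 : (0 : ℝ) < q := by linarith
  have hc : 0 < Real.cos (Real.pi / q) := by
    apply Real.cos_pos_of_mem_Ioo
    constructor
    · have := Real.pi_pos
      have : 0 < Real.pi / q := by positivity
      linarith
    · exact div_lt_div_of_pos_left Real.pi_pos two_pos (by linarith)
  have hodd : a ≤ 1 / (2 * Real.cos (Real.pi / q)) ↔ 0 ≤ 1 - 2 * a * Real.cos (Real.pi / q) := by
    rw [le_div_iff₀ (by positivity)]
    constructor <;> intro h <;> linarith
  rw [hodd]
  constructor
  · refine fun h => ⟨fun ⟨m, hm⟩ => ?_, fun ⟨m, hm⟩ => ?_⟩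
    · have := h ⟨m, by omega⟩
      have e : 2 * Real.pi * m / q = Real.pi := by
        have : (q : ℝ) = m + m := by exact_mod_cast hm
        rw [div_eq_iff hq0.ne', this]
        ring
      rw [e, Real.cos_pi] at this
      linarith
    · have := h ⟨m, by omega⟩
      have e : 2 * Real.pi * m / q = Real.pi - Real.pi / q := by
        have : (q : ℝ) = 2 * m + 1 := by exact_mod_cast hm
        field_simp
        rw [this]
        ring
      rw [e, Real.cos_pi_sub] at this
      linarith
  · rintro ⟨he, ho⟩ k
    rcases Nat.even_or_odd q with h | h
    · nlinarith [he h, Real.neg_one_le_cos (2 * Real.pi * k / q)]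
    · nlinarith [ho h, mul_le_mul_of_nonneg_left
        (Real.neg_cos_pi_div_le_cos_of_odd h k.isLt.le) ha]

/- Statement 19: the eigenvalues of `cycMatrix q a` (for `a ≥ 0`, `q ≥ 3`) are exactly
the numbers `1 + 2a cos(2πk/q)`, `k = 0, …, q-1`; hence it is positive semidefinite
(`∀ v, 0 ≤ v ⬝ᵥ A v`) iff all these are nonnegative, iff `a ≤ 1/2` for even `q` and
`a ≤ 1/(2cos(π/q))` for odd `q`. -/
theorem stmt19 (q : ℕ) [NeZero q] (hq : 3 ≤ q) (a : ℝ) (ha : 0 ≤ a) :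
    (∀ μ : ℝ, (∃ v : ZMod q → ℝ, v ≠ 0 ∧ (cycMatrix q a).mulVec v = μ • v) ↔
      ∃ k : Fin q, μ = 1 + 2 * a * Real.cos (2 * Real.pi * k / q)) ∧
    ((∀ v : ZMod q → ℝ, 0 ≤ v ⬝ᵥ (cycMatrix q a).mulVec v) ↔
      ∀ k : Fin q, 0 ≤ 1 + 2 * a * Real.cos (2 * Real.pi * k / q)) ∧
    ((∀ v : ZMod q → ℝ, 0 ≤ v ⬝ᵥ (cycMatrix q a).mulVec v) ↔
      ((Even q → a ≤ 1 / 2) ∧ (Odd q → a ≤ 1 / (2 * Real.cos (Real.pi / q))))) := by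
  have hev : ∀ μ : ℝ, (∃ v : ZMod q → ℝ, v ≠ 0 ∧ (cycMatrix q a).mulVec v = μ • v) ↔
      ∃ k : Fin q, μ = 1 + 2 * a * Real.cos (2 * Real.pi * k / q) := fun μ =>
    ⟨fun ⟨v, hv, h⟩ => cycMatrix_eigenvalue_eq q hq a μ v hv h,
      fun ⟨k, hk⟩ => hk ▸ exists_cycMatrix_eigenvector q hq a k⟩
  have hpsd : (∀ v : ZMod q → ℝ, 0 ≤ v ⬝ᵥ (cycMatrix q a).mulVec v) ↔
      ∀ k : Fin q, 0 ≤ 1 + 2 * a * Real.cos (2 * Real.pi * k / q) := by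
    rw [(cycMatrix_isHermitian q a).dotProduct_mulVec_nonneg_iff]
    simp only [hev]
    exact ⟨fun h k => h _ ⟨k, rfl⟩, fun h μ ⟨k, hk⟩ => hk ▸ h k⟩
  exact ⟨hev, hpsd, hpsd.trans (forall_one_add_two_mul_cos_nonneg_iff hq ha)⟩
end
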